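/- arXiv:2503.23203 — 3 statements merged into one kernel-verified Lean document; each statement's English description precedes it below -/
import Mathlib

section
/- Let f ∈ 𝒞_c(G), and suppose there exist open bisections V₁,…,V_n ⊆ G and a compact set K ⊆ V₁ ∪ ⋯ ∪ V_n with supp°(f) ⊆ K. Then there exist f₁,…,f_n with f_i ∈ C_c(V_i) for all i and f = f₁ + ⋯ + f_n. -/
/-! Basic framework: (possibly non-Hausdorff) topological groupoids, open bisections,
the convolution algebra `𝒞_c(G)`. -/

/-- The data of a topological groupoid on a topological space `G`:
unit space `X ⊆ G`, range and source maps `r, s : G → G` (with values in `X`),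
inversion and a (partial, defined on composable pairs) multiplication, all continuous
(multiplication on the set of composable pairs), satisfying the groupoid axioms. -/
structure GroupoidData (G : Type) [TopologicalSpace G] : Type where
  X : Set G
  r : G → G
  s : G → G
  inv : G → G
  mul : G → G → G
  r_mem : ∀ g, r g ∈ X
  s_mem : ∀ g, s g ∈ X
  r_unit : ∀ x ∈ X, r x = x
  s_unit : ∀ x ∈ X, s x = x
  continuous_r : Continuous r
  continuous_s : Continuous s
  continuous_inv : Continuous inv
  continuousOn_mul : ContinuousOn (fun p : G × G => mul p.1 p.2) {p : G × G | s p.1 = r p.2}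
  r_inv : ∀ g, r (inv g) = s g
  s_inv : ∀ g, s (inv g) = r g
  inv_inv : ∀ g, inv (inv g) = g
  r_mul : ∀ g h, s g = r h → r (mul g h) = r g
  s_mul : ∀ g h, s g = r h → s (mul g h) = s h
  mul_assoc : ∀ g h k, s g = r h → s h = r k → mul (mul g h) k = mul g (mul h k)
  mul_inv : ∀ g, mul g (inv g) = r g
  inv_mul : ∀ g, mul (inv g) g = s g
  mul_unit : ∀ g, mul g (s g) = g
  unit_mul : ∀ g, mul (r g) g = g

variable {G : Type} [TopologicalSpace G]

/-- An open bisection: an open set on which both `r` and `s` are injective and restrict to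
open maps (hence homeomorphisms onto open subsets of the unit space). -/
def GroupoidData.IsOpenBisection (D : GroupoidData G) (U : Set G) : Prop :=
  IsOpen U ∧ Set.InjOn D.r U ∧ Set.InjOn D.s U ∧
    (∀ V ⊆ U, IsOpen V → IsOpen (D.r '' V)) ∧ (∀ V ⊆ U, IsOpen V → IsOpen (D.s '' V))

/-- The groupoid is étale: it is covered by open bisections. -/
def GroupoidData.IsEtale (D : GroupoidData G) : Prop :=
  ∀ g : G, ∃ U : Set G, D.IsOpenBisection U ∧ g ∈ U

/-- `f : G → ℂ` is (the extension by zero of) a continuous compactly supported function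
on the open set `U`. -/
def MemCc (U : Set G) (f : G → ℂ) : Prop :=
  ContinuousOn f U ∧ (∀ g ∉ U, f g = 0) ∧
    ∃ K : Set G, IsCompact K ∧ K ⊆ U ∧ ∀ g, f g ≠ 0 → g ∈ K

/-- The convolution algebra `𝒞_c(G)`, as a linear subspace of functions `G → ℂ`:
the span of the `C_c(U)` over all open bisections `U`. -/
noncomputable def GroupoidData.CcSpan (D : GroupoidData G) : Submodule ℂ (G → ℂ) :=
  Submodule.span ℂ {f : G → ℂ | ∃ U : Set G, D.IsOpenBisection U ∧ MemCc U f}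

open Set Function Topology Filter

section SheetLift

variable {α Y : Type*} {p : α → Y}

/-- The function that is `a ∘ p` on `U` and vanishes off `U`. -/
noncomputable def sheetLift (p : α → Y) (a : Y → ℂ) (U : Set α) : α → ℂ :=
  U.indicator (a ∘ p)

theorem sheetLift_of_mem {a : Y → ℂ} {U : Set α} {g : α} (hg : g ∈ U) :
    sheetLift p a U g = a (p g) := indicator_of_mem hg _

theorem sheetLift_of_notMem {a : Y → ℂ} {U : Set α} {g : α} (hg : g ∉ U) :
    sheetLift p a U g = 0 := indicator_of_notMem hg _

theorem sheetLift_add (a b : Y → ℂ) (U : Set α) :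
    sheetLift p (a + b) U = sheetLift p a U + sheetLift p b U :=
  indicator_add U (a ∘ p) (b ∘ p)

theorem sheetLift_zero (U : Set α) : sheetLift p 0 U = 0 :=
  indicator_zero ℂ U

theorem sheetLift_sum {ι : Type*} (t : Finset ι) (a : ι → Y → ℂ) (U : Set α) :
    sheetLift p (∑ l ∈ t, a l) U = ∑ l ∈ t, sheetLift p (a l) U := by
  classical
  induction t using Finset.induction_on with
  | empty => simp [sheetLift_zero]
  | insert m t hm ih => rw [Finset.sum_insert hm, Finset.sum_insert hm, sheetLift_add, ih]

end SheetLift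

section Sheets

variable {Y : Type*} [TopologicalSpace Y] {p : G → Y}

/-- A sheet of `p` is an open set on which `p` restricts to an open embedding. -/
structure IsSheet (p : G → Y) (U : Set G) : Prop where
  isOpen : IsOpen U
  isOpenEmbedding : IsOpenEmbedding (U.domRestrict p)

theorem IsSheet.isOpen_image_inter {U V : Set G} (hU : IsSheet p U) (hV : IsOpen V) :
    IsOpen (p '' (U ∩ V)) := by
  have h := hU.isOpenEmbedding.isOpenMap _ (hV.preimage continuous_subtype_val)
  convert h using 1
  ext y
  simp [Set.domRestrict, and_assoc, and_left_comm]

theorem IsSheet.isOpen_image {U : Set G} (hU : IsSheet p U) : IsOpen (p '' U) := by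
  simpa using hU.isOpen_image_inter isOpen_univ

theorem IsSheet.injOn {U : Set G} (hU : IsSheet p U) : InjOn p U :=
  injOn_iff_injective.2 hU.isOpenEmbedding.injective

theorem memCc_zero (U : Set G) : MemCc U 0 :=
  ⟨continuousOn_const, fun _ _ => rfl, ∅, isCompact_empty, empty_subset _,
    fun _ h => (h rfl).elim⟩

theorem MemCc.add {U : Set G} {f g : G → ℂ} (hf : MemCc U f) (hg : MemCc U g) :
    MemCc U (f + g) := by
  obtain ⟨hfc, hf0, K, hK, hKU, hfK⟩ := hf
  obtain ⟨hgc, hg0, L, hL, hLU, hgL⟩ := hg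
  refine ⟨hfc.add hgc, fun x hx => by simp [hf0 x hx, hg0 x hx], K ∪ L, hK.union hL,
    union_subset hKU hLU, fun x hx => ?_⟩
  by_contra h
  rw [mem_union, not_or] at h
  exact hx (by simp [not_not.1 (mt (hfK x) h.1), not_not.1 (mt (hgL x) h.2)])

theorem MemCc.sum {ι : Type*} {U : Set G} {f : ι → G → ℂ} (t : Finset ι)
    (hf : ∀ i ∈ t, MemCc U (f i)) : MemCc U (∑ i ∈ t, f i) :=
  Finset.sum_induction f (MemCc U) (fun _ _ => MemCc.add) (memCc_zero U) hf

theorem MemCc.const_smul {U : Set G} {f : G → ℂ} (c : ℂ) (hf : MemCc U f) :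
    MemCc U (c • f) := by
  obtain ⟨hfc, hf0, K, hK, hKU, hfK⟩ := hf
  exact ⟨hfc.const_smul c, fun x hx => by simp [hf0 x hx], K, hK, hKU,
    fun x hx => hfK x fun h => hx (by simp [h])⟩

theorem memCc_sheetLift (hp : Continuous p) {U : Set G} (hU : IsSheet p U) {a : Y → ℂ}
    (ha : Continuous a) {L : Set Y} (hL : IsCompact L) (hLU : L ⊆ p '' U)
    (haL : support a ⊆ L) : MemCc U (sheetLift p a U) := by
  refine ⟨(ha.comp hp).continuousOn.congr fun g hg => sheetLift_of_mem hg,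
    fun g hg => sheetLift_of_notMem hg, (↑) '' (U.domRestrict p ⁻¹' L), ?_, ?_, ?_⟩
  · exact (hU.isOpenEmbedding.isInducing.isCompact_preimage' hL
      (by rwa [range_domRestrict])).image continuous_subtype_val
  · rintro _ ⟨u, -, rfl⟩
    exact u.2
  · intro g hg
    have hgU : g ∈ U := mem_of_indicator_ne_zero hg
    rw [sheetLift_of_mem hgU] at hg
    exact ⟨⟨g, hgU⟩, haL hg, rfl⟩

theorem MemCc.exists_eq_sheetLift [T2Space Y] (hp : Continuous p) {U : Set G}
    (hU : IsSheet p U) {f : G → ℂ} (hf : MemCc U f) :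
    ∃ (a : Y → ℂ) (L : Set Y), Continuous a ∧ IsCompact L ∧ L ⊆ p '' U ∧ support a ⊆ L ∧
      f = sheetLift p a U := by
  obtain ⟨hfc, hf0, K, hK, hKU, hfK⟩ := hf
  have hext (u : U) : extend (U.domRestrict p) (U.domRestrict f) 0 (p u) = f u :=
    hU.isOpenEmbedding.injective.extend_apply _ _ u
  have hsupp : support (extend (U.domRestrict p) (U.domRestrict f) 0) ⊆ p '' K := by
    intro y hy
    by_cases h : ∃ u, U.domRestrict p u = y
    · obtain ⟨u, rfl⟩ := h
      exact ⟨u, hfK u (by rwa [mem_support, domRestrict_apply, hext] at hy), rfl⟩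
    · exact (hy (extend_apply' _ _ _ h)).elim
  refine ⟨extend (U.domRestrict p) (U.domRestrict f) 0, p '' K, ?_, hK.image hp, image_mono hKU,
    hsupp, ?_⟩
  · refine continuous_iff_continuousAt.2 fun y => ?_
    by_cases hy : y ∈ p '' K
    · obtain ⟨g, hg, rfl⟩ := hy
      refine (hU.isOpenEmbedding.continuousAt_iff (x := (⟨g, hKU hg⟩ : U))).1 ?_
      rw [extend_comp hU.isOpenEmbedding.injective]
      exact (continuousOn_iff_continuous_domRestrict.1 hfc).continuousAt
    · refine (continuousAt_const (y := (0 : ℂ))).congr ?_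
      filter_upwards [(hK.image hp).isClosed.isOpen_compl.mem_nhds hy] with z hz
      exact (notMem_support.1 fun h => hz (hsupp h)).symm
  · ext g
    by_cases hg : g ∈ U
    · rw [sheetLift_of_mem hg, hext ⟨g, hg⟩]
    · rw [sheetLift_of_notMem hg, hf0 g hg]

/-- A continuous compactly supported function whose open support is covered by finitely many
open sets is a sum of continuous functions with open supports in the members of the cover. -/
theorem exists_sum_eq_of_support_subset_iUnion {ι : Type*} [T2Space Y]
    [LocallyCompactSpace Y] [Fintype ι] {a : Y → ℂ} (ha : Continuous a) {L : Set Y}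
    (hL : IsCompact L) (haL : support a ⊆ L) {O : ι → Set Y} (hO : ∀ l, IsOpen (O l))
    (haO : support a ⊆ ⋃ l, O l) :
    ∃ c : ι → Y → ℂ, (∀ l, Continuous (c l)) ∧ (∀ l, support (c l) ⊆ support a ∩ O l) ∧
      a = ∑ l, c l := by
  classical
  have hS : IsOpen (support a) := ha.isOpen_support
  have hσ : IsSigmaCompact (support a) := by
    refine ⟨fun n : ℕ => {y | 1 / ((n : ℝ) + 1) ≤ ‖a y‖}, fun n => ?_, ?_⟩
    · refine hL.of_isClosed_subset (isClosed_le continuous_const ha.norm) fun y hy => haL ?_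
      have : (0 : ℝ) < 1 / ((n : ℝ) + 1) := by positivity
      exact norm_pos_iff.1 (this.trans_le hy)
    · ext y
      simp only [mem_iUnion, mem_ofPred_eq, mem_support]
      constructor
      · rintro ⟨n, hn⟩
        have : (0 : ℝ) < 1 / ((n : ℝ) + 1) := by positivity
        exact norm_pos_iff.1 (this.trans_le hn)
      · intro hy
        obtain ⟨n, hn⟩ := exists_nat_one_div_lt (norm_pos_iff.2 hy)
        exact ⟨n, hn.le⟩
  have : SigmaCompactSpace (support a) := isSigmaCompact_iff_sigmaCompactSpace.1 hσ
  have : LocallyCompactSpace (support a) := hS.locallyCompactSpace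
  obtain ⟨ρ, hρ⟩ := PartitionOfUnity.exists_isSubordinate (isClosed_univ (X := support a))
    (fun l => (↑) ⁻¹' O l) (fun l => (hO l).preimage continuous_subtype_val)
    (fun y _ => by simpa using haO y.2)
  let c : ι → Y → ℂ := fun l y => if h : a y ≠ 0 then a y * (ρ l ⟨y, h⟩ : ℂ) else 0
  have hc (l : ι) (y : support a) : c l y = a y * (ρ l y : ℂ) := dif_pos y.2
  have hc0 (l : ι) {y : Y} (hy : a y = 0) : c l y = 0 := dif_neg (not_not.2 hy)
  refine ⟨c, fun l => continuous_iff_continuousAt.2 fun y => ?_, fun l y hy => ?_, ?_⟩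
  · by_cases hy : a y = 0
    · rw [ContinuousAt, hc0 l hy]
      refine squeeze_zero_norm (a := fun z => ‖a z‖) (fun z => ?_)
        (by simpa [hy] using ha.norm.tendsto y)
      by_cases hz : a z = 0
      · simp [hc0 l hz]
      · rw [hc l ⟨z, hz⟩, norm_mul, Complex.norm_real, Real.norm_of_nonneg (ρ.nonneg l _)]
        exact mul_le_of_le_one_right (norm_nonneg _) (ρ.le_one l _)
    · refine (hS.isOpenEmbedding_subtypeVal.continuousAt_iff (x := ⟨y, hy⟩)).1 ?_
      have : c l ∘ ((↑) : support a → Y) = fun z : support a => a z * (ρ l z : ℂ) := funext (hc l)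
      rw [this]
      have := (ρ l).continuous
      fun_prop
  · have hay : a y ≠ 0 := fun h => hy (hc0 l h)
    refine ⟨hay, hρ l (subset_tsupport _ ?_ : (⟨y, hay⟩ : support a) ∈ tsupport (ρ l))⟩
    intro h
    exact hy (by rw [hc l ⟨y, hay⟩, h]; simp)
  · ext y
    rw [Finset.sum_apply]
    by_cases hy : a y = 0
    · simp [hc0 _ hy, hy]
    · have h1 : ∑ l, ρ l ⟨y, hy⟩ = 1 := by
        rw [← finsum_eq_sum_of_fintype]
        exact ρ.sum_eq_one (mem_univ _)
      simp_rw [hc _ ⟨y, hy⟩, ← Finset.mul_sum, ← Complex.ofReal_sum, h1]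
      simp

/-- If all sheets lie over a common compact set `L` and the sum is supported in the sheets
indexed by `T`, the remaining sheets can be eliminated. -/
theorem exists_sum_sheetLift_eq [T2Space Y] [LocallyCompactSpace Y] {ι : Type*} [Fintype ι]
    [DecidableEq ι] {U : ι → Set G} (hU : ∀ l, IsSheet p (U l)) {L : Set Y} (hL : IsCompact L)
    (T : Finset ι) {f : G → ℂ} (hfT : ∀ g, f g ≠ 0 → ∃ l ∈ T, g ∈ U l) (s : Finset ι) :
    (∀ l ∈ s, l ∉ T) → (∀ l ∈ s, L ⊆ p '' U l) →
      ∀ a : ι → Y → ℂ, (∀ l, Continuous (a l)) → (∀ l, support (a l) ⊆ L) →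
        f = ∑ l ∈ T ∪ s, sheetLift p (a l) (U l) →
        ∃ b : ι → Y → ℂ, (∀ l, Continuous (b l)) ∧ (∀ l, support (b l) ⊆ L) ∧
          f = ∑ l ∈ T, sheetLift p (b l) (U l) := by
  induction s using Finset.induction_on with
  | empty =>
    intro _ _ a ha haL hf
    exact ⟨a, ha, haL, by simpa using hf⟩
  | insert m s hm ih =>
    intro hsT hsL a ha haL hf
    have hmR : m ∉ T ∪ s := by
      simpa [hm] using hsT m (Finset.mem_insert_self m s)
    rw [Finset.union_insert, Finset.sum_insert hmR] at hf
    obtain ⟨c, hc, hcO, hac⟩ := exists_sum_eq_of_support_subset_iUnion (ha m) hL (haL m)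
      (O := fun l => if l ∈ T ∪ s then p '' (U m ∩ U l) else ∅)
      (fun l => by
        split_ifs
        · exact (hU m).isOpen_image_inter (hU l).isOpen
        · exact isOpen_empty)
      (by
        intro y hy
        obtain ⟨g, hg, rfl⟩ := hsL m (Finset.mem_insert_self m s) (haL m hy)
        by_contra hcov
        have hgR : ∀ l ∈ T ∪ s, g ∉ U l := fun l hl hgl =>
          hcov (mem_iUnion.2 ⟨l, by rw [if_pos hl]; exact ⟨g, ⟨hg, hgl⟩, rfl⟩⟩)
        have hfg : f g = a m (p g) := by
          rw [hf, Pi.add_apply, Finset.sum_apply,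
            Finset.sum_eq_zero fun l hl => sheetLift_of_notMem (hgR l hl), add_zero,
            sheetLift_of_mem hg]
        obtain ⟨l, hl, hgl⟩ := hfT g (by rwa [hfg])
        exact hgR l (Finset.mem_union_left _ hl) hgl)
    have hswap : ∀ l ∈ T ∪ s, sheetLift p (c l) (U m) = sheetLift p (c l) (U l) := by
      intro l hl
      have key (g : G) (hg : g ∈ U m ∨ g ∈ U l) (hcg : c l (p g) ≠ 0) : g ∈ U m ∩ U l := by
        have h := (hcO l hcg).2
        rw [if_pos hl] at h
        obtain ⟨g', hg', hgg⟩ := h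
        rcases hg with hg | hg
        · rwa [(hU m).injOn hg hg'.1 hgg.symm]
        · rwa [(hU l).injOn hg hg'.2 hgg.symm]
      ext g
      by_cases hcg : c l (p g) = 0
      · simp [sheetLift, indicator, hcg]
      · by_cases hg : g ∈ U m ∨ g ∈ U l
        · have h := key g hg hcg
          rw [sheetLift_of_mem h.1, sheetLift_of_mem h.2]
        · rw [not_or] at hg
          rw [sheetLift_of_notMem hg.1, sheetLift_of_notMem hg.2]
    have hac' : a m = ∑ l ∈ T ∪ s, c l := by
      rw [hac]
      refine (Finset.sum_subset (Finset.subset_univ _) fun l _ hl => ?_).symm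
      refine support_eq_empty_iff.1 (subset_empty_iff.1 fun y hy => ?_)
      simpa [hl] using (hcO l hy).2
    refine ih (fun l hl => hsT l (Finset.mem_insert_of_mem hl))
      (fun l hl => hsL l (Finset.mem_insert_of_mem hl)) (fun l => a l + c l)
      (fun l => (ha l).add (hc l)) (fun l => ?_) ?_
    · exact (support_add _ _).trans
        (union_subset (haL l) (((hcO l).trans inter_subset_left).trans (haL m)))
    · rw [hf, hac', sheetLift_sum, Finset.sum_congr rfl hswap, ← Finset.sum_add_distrib]
      exact Finset.sum_congr rfl fun l _ => by rw [sheetLift_add, add_comm]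

/-- The decomposition exists after cutting down to a neighbourhood of a point of the base. -/
theorem exists_nhds_decomposition [T2Space Y] [LocallyCompactSpace Y] (hp : Continuous p)
    {ι κ : Type*} [Fintype ι] [Fintype κ] {U : ι → Set G} (hU : ∀ j, IsSheet p (U j))
    {V : κ → Set G} (hV : ∀ i, IsSheet p (V i)) {a : ι → Y → ℂ} (ha : ∀ j, Continuous (a j))
    {L : ι → Set Y} (hL : ∀ j, IsCompact (L j)) (hLU : ∀ j, L j ⊆ p '' U j)
    (haL : ∀ j, support (a j) ⊆ L j) {K : Set G} (hK : IsCompact K) (hKV : K ⊆ ⋃ i, V i)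
    (hfK : ∀ g, (∑ j, sheetLift p (a j) (U j)) g ≠ 0 → g ∈ K) (x : Y) :
    ∃ W ∈ 𝓝 x, ∀ φ : Y → ℂ, Continuous φ → support φ ⊆ W →
      ∃ fs : κ → G → ℂ, (∀ i, MemCc (V i) (fs i)) ∧
        (φ ∘ p) * (∑ j, sheetLift p (a j) (U j)) = ∑ i, fs i := by
  classical
  set f := ∑ j, sheetLift p (a j) (U j) with hf
  have h1 : ∀ᶠ y in 𝓝 x, ∀ j, x ∈ p '' U j → y ∈ p '' U j := by
    refine eventually_all.2 fun j => ?_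
    by_cases hx : x ∈ p '' U j
    · filter_upwards [(hU j).isOpen_image.mem_nhds hx] with y hy _ using hy
    · exact .of_forall fun y h => (hx h).elim
  have h2 : ∀ᶠ y in 𝓝 x, ∀ j, x ∉ p '' U j → a j y = 0 := by
    refine eventually_all.2 fun j => ?_
    by_cases hx : x ∈ p '' U j
    · exact .of_forall fun y h => (h hx).elim
    · filter_upwards [(hL j).isClosed.isOpen_compl.mem_nhds fun h => hx (hLU j h)] with y hy _
      exact notMem_support.1 fun h => hy (haL j h)
  have h3 : ∀ᶠ y in 𝓝 x, ∀ i, x ∈ p '' V i → y ∈ p '' V i := by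
    refine eventually_all.2 fun i => ?_
    by_cases hx : x ∈ p '' V i
    · filter_upwards [(hV i).isOpen_image.mem_nhds hx] with y hy _ using hy
    · exact .of_forall fun y h => (hx h).elim
  have h4 : ∀ᶠ y in 𝓝 x, ∀ g ∈ K, p g = y → ∃ i, x ∈ p '' V i ∧ g ∈ V i := by
    have hK' : IsCompact (p '' (K \ ⋃ i, ⋃ _ : x ∈ p '' V i, V i)) :=
      (hK.diff (isOpen_iUnion fun i => isOpen_iUnion fun _ => (hV i).isOpen)).image hp
    have hx : x ∉ p '' (K \ ⋃ i, ⋃ _ : x ∈ p '' V i, V i) := by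
      rintro ⟨g, ⟨hgK, hg⟩, rfl⟩
      obtain ⟨i, hi⟩ := mem_iUnion.1 (hKV hgK)
      exact hg (mem_iUnion₂.2 ⟨i, mem_image_of_mem p hi, hi⟩)
    filter_upwards [hK'.isClosed.isOpen_compl.mem_nhds hx] with y hy g hg hgy
    by_contra hcon
    refine hy ⟨g, ⟨hg, fun h => hcon ?_⟩, hgy⟩
    simpa only [mem_iUnion, exists_prop] using h
  obtain ⟨N, hN, hNsub, hNc⟩ := local_compact_nhds (h1.and (h2.and (h3.and h4)))
  refine ⟨N, hN, fun φ hφ hφN => ?_⟩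
  let A : Finset ι := {j | x ∈ p '' U j}
  let B : Finset κ := {i | x ∈ p '' V i}
  have hA (j : ι) : j ∈ A ↔ x ∈ p '' U j := by simp [A]
  have hB (i : κ) : i ∈ B ↔ x ∈ p '' V i := by simp [B]
  have hmul (j : ι) : (φ ∘ p) * sheetLift p (a j) (U j) = sheetLift p (φ * a j) (U j) := by
    ext g
    by_cases hg : g ∈ U j
    · simp [sheetLift_of_mem hg]
    · simp [sheetLift_of_notMem hg]
  have hbad (j : ι) (hj : j ∉ A) : φ * a j = 0 := by
    ext y
    by_cases hy : φ y = 0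
    · simp [hy]
    · simp [(hNsub (hφN hy)).2.1 j (mt (hA j).2 hj)]
  have hdisj : Disjoint (B.map Embedding.inr) (A.map (Embedding.inl : ι ↪ ι ⊕ κ)) :=
    Finset.disjoint_left.2 (by simp)
  obtain ⟨b, hb, hbN, hfb⟩ := exists_sum_sheetLift_eq (p := p) (U := Sum.elim U V)
    (f := (φ ∘ p) * f) (by rintro (j | i); exacts [hU j, hV i]) hNc
    (B.map Embedding.inr) (by
      intro g hg
      have hg' : φ (p g) ≠ 0 ∧ f g ≠ 0 := by simpa using hg
      obtain ⟨i, hi, hgi⟩ := (hNsub (hφN hg'.1)).2.2.2 g (hfK g hg'.2) rfl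
      exact ⟨Sum.inr i, by simpa [hB] using hi, hgi⟩)
    (A.map Embedding.inl) (by simp)
    (by
      intro l hl
      obtain ⟨j, hj, rfl⟩ := Finset.mem_map.1 hl
      exact fun y hy => (hNsub hy).1 j ((hA j).1 hj))
    (Sum.elim (fun j => φ * a j) fun _ => 0)
    (by rintro (j | i); exacts [hφ.mul (ha j), continuous_const])
    (by
      rintro (j | i) y hy
      · exact hφN (left_ne_zero_of_mul hy)
      · exact (hy rfl).elim)
    (by
      rw [Finset.sum_union hdisj, Finset.sum_map, Finset.sum_map]
      simp only [Embedding.inr_apply, Embedding.inl_apply, Sum.elim_inl, Sum.elim_inr,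
        sheetLift_zero, Finset.sum_const_zero, zero_add]
      rw [hf, Finset.mul_sum, Finset.sum_congr rfl fun j _ => hmul j]
      refine (Finset.sum_subset (Finset.subset_univ _) fun j _ hj => ?_).symm
      rw [hbad j hj, sheetLift_zero])
  refine ⟨fun i => if i ∈ B then sheetLift p (b (Sum.inr i)) (V i) else 0, fun i => ?_, ?_⟩
  · dsimp only
    split_ifs with hi
    · exact memCc_sheetLift hp (hV i) (hb _) hNc
        (fun y hy => (hNsub hy).2.2.1 i ((hB i).1 hi)) (hbN _)
    · exact memCc_zero _
  · rw [hfb, Finset.sum_map, Finset.sum_ite_mem, Finset.univ_inter]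
    rfl

/-- A sum of compactly supported functions on sheets whose open support lies in a compact subset
of `⋃ i, V i` is a sum of compactly supported functions on the sheets `V i`. -/
theorem exists_decomposition [T2Space Y] [LocallyCompactSpace Y] (hp : Continuous p)
    {ι κ : Type*} [Fintype ι] [Fintype κ] {U : ι → Set G} (hU : ∀ j, IsSheet p (U j))
    {V : κ → Set G} (hV : ∀ i, IsSheet p (V i)) {F : ι → G → ℂ} (hF : ∀ j, MemCc (U j) (F j))
    {K : Set G} (hK : IsCompact K) (hKV : K ⊆ ⋃ i, V i)
    (hFK : ∀ g, (∑ j, F j) g ≠ 0 → g ∈ K) :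
    ∃ fs : κ → G → ℂ, (∀ i, MemCc (V i) (fs i)) ∧ ∑ j, F j = ∑ i, fs i := by
  choose a L ha hL hLU haL hFa using fun j => (hF j).exists_eq_sheetLift hp (hU j)
  obtain rfl : F = fun j => sheetLift p (a j) (U j) := funext hFa
  choose W hW hdec using exists_nhds_decomposition hp hU hV ha hL hLU haL hK hKV hFK
  obtain ⟨t, ht⟩ := (hK.image hp).elim_finite_subcover (fun x => interior (W x))
    (fun _ => isOpen_interior)
    (fun x _ => mem_iUnion.2 ⟨x, mem_interior_iff_mem_nhds.2 (hW x)⟩)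
  obtain ⟨φ, hφW, hφ1, -⟩ := exists_continuous_sum_one_of_isOpen_isCompact
    (s := fun k : Fin t.card => interior (W (t.equivFin.symm k)))
    (fun _ => isOpen_interior) (hK.image hp) (fun y hy => by
      obtain ⟨x, hx, hyx⟩ := mem_iUnion₂.1 (ht hy)
      exact mem_iUnion.2 ⟨t.equivFin ⟨x, hx⟩, by simpa using hyx⟩)
  choose fs hfs hsum using fun k => hdec (t.equivFin.symm k) (fun y => (φ k y : ℂ))
    (Complex.continuous_ofReal.comp (φ k).continuous) (fun y hy =>
      interior_subset (hφW k (subset_tsupport _ (by simpa using hy))))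
  refine ⟨fun i => ∑ k, fs k i, fun i => MemCc.sum _ fun k _ => hfs k i, ?_⟩
  rw [Finset.sum_comm, ← Finset.sum_congr rfl fun k _ => hsum k, ← Finset.sum_mul]
  ext g
  by_cases hg : (∑ j, sheetLift p (a j) (U j)) g = 0
  · rw [Pi.mul_apply, hg, mul_zero]
  · have h := hφ1 (mem_image_of_mem p (hFK g hg))
    have h' : ∑ k, (φ k (p g) : ℂ) = 1 := by
      rw [← Complex.ofReal_sum]
      exact congrArg _ (by simpa using h)
    simp [h']

end Sheets

theorem GroupoidData.IsOpenBisection.isSheet {D : GroupoidData G} {U : Set G}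
    (hU : D.IsOpenBisection U) : IsSheet (fun g => (⟨D.s g, D.s_mem g⟩ : D.X)) U := by
  obtain ⟨hUo, -, hinj, -, hopen⟩ := hU
  have hcont : Continuous fun g => (⟨D.s g, D.s_mem g⟩ : D.X) :=
    D.continuous_s.subtype_mk _
  refine ⟨hUo, .of_continuous_injective_isOpenMap (hcont.comp continuous_subtype_val) ?_ ?_⟩
  · intro u v huv
    exact Subtype.ext (hinj u.2 v.2 (congrArg Subtype.val huv))
  · intro O hO
    have h := hopen (Subtype.val '' O) (Subtype.coe_image_subset U O)
      (hUo.isOpenMap_subtype_val O hO)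
    convert h.preimage (continuous_subtype_val (p := (· ∈ D.X))) using 1
    ext y
    simp [Subtype.ext_iff, Set.domRestrict]

/-- Let `f ∈ 𝒞_c(G)`, and suppose there are open bisections `V₁, …, V_n` and
a compact set `K ⊆ V₁ ∪ ⋯ ∪ V_n` with `supp°(f) ⊆ K`.  Then there are `f₁, …, f_n` with
`f_i ∈ C_c(V_i)` for all `i` and `f = f₁ + ⋯ + f_n`. -/
theorem stmt10 [LocallyCompactSpace G] (D : GroupoidData G) [T2Space ↥D.X]
    (hXopen : IsOpen D.X) (hetale : D.IsEtale)
    (f : G → ℂ) (hf : f ∈ D.CcSpan)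
    (n : ℕ) (V : Fin n → Set G) (hV : ∀ i, D.IsOpenBisection (V i))
    (K : Set G) (hK : IsCompact K) (hKV : K ⊆ ⋃ i, V i)
    (hsupp : ∀ g : G, f g ≠ 0 → g ∈ K) :
    ∃ fs : Fin n → G → ℂ, (∀ i, MemCc (V i) (fs i)) ∧ f = ∑ i, fs i := by
  have : LocallyCompactSpace D.X := hXopen.locallyCompactSpace
  obtain ⟨m, c, F, rfl⟩ := Submodule.mem_span_set'.1 hf
  choose U hU hFU using fun j => (F j).2
  exact exists_decomposition (D.continuous_s.subtype_mk D.s_mem) (fun j => (hU j).isSheet)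
    (fun i => (hV i).isSheet) (fun j => (hFU j).const_smul (c j)) hK hKV hsupp
end

section
/- Let G be a non-Hausdorff ample groupoid and R a ring. The singular ideal J_R of the Steinberg algebra RG is nonzero if and only if there exists t ∈ ord(R) such that G satisfies condition (𝒮_t). -/
variable {G : Type} [TopologicalSpace G]

/-- The Steinberg algebra `RG` (as an additive subgroup of functions `G → R`): the span of the
functions `c_U` taking a constant value `c ∈ R` on a compact open bisection `U` and `0`
elsewhere. -/
def GroupoidData.Steinberg (D : GroupoidData G) (R : Type) [NonUnitalRing R] :
    AddSubgroup (G → R) :=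
  AddSubgroup.closure {f : G → R | ∃ (c : R) (U : Set G),
    IsCompact U ∧ D.IsOpenBisection U ∧ f = Set.indicator U (fun _ => c)}

/-- Condition `(𝒮)` over a coefficient ring `K` (taking `K = ℚ` gives condition `(𝒮₀)` and
`K = ℤ/tℤ` gives condition `(𝒮_t)` for `t > 1`): there exist `n ≥ 1` and open bisections
`U₁, …, U_n` with `s(U_i) = s(U_j)` for all `i, j`, such that each `U_i \ ⋃_{j ≠ i} U_j` is
nonempty with empty interior, and such that the `K`-span of the vectors
`b_I = ∑_{i ∈ I} e_i`, over subsets `I ⊆ {1, …, n}` with `#I > 1` and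
`(⋂_{i ∈ I} U_i) \ (⋃_{j ∉ I} U_j) ≠ ∅`, is a proper submodule of `K^n`. -/
def GroupoidData.ConditionS (D : GroupoidData G) (K : Type) [CommRing K] : Prop :=
  ∃ (n : ℕ) (U : Fin n → Set G), 0 < n ∧
    (∀ i, D.IsOpenBisection (U i)) ∧
    (∀ i j, D.s '' U i = D.s '' U j) ∧
    (∀ i, (U i \ ⋃ (j) (_ : j ≠ i), U j).Nonempty) ∧
    (∀ i, interior (U i \ ⋃ (j) (_ : j ≠ i), U j) = ∅) ∧
    Submodule.span K {b : Fin n → K | ∃ I : Finset (Fin n), 1 < I.card ∧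
      ((⋂ i ∈ I, U i) \ ⋃ (j) (_ : j ∉ I), U j).Nonempty ∧
      b = fun i => if i ∈ I then (1 : K) else 0} ≠ ⊤

/-- A subset of `Fin n` viewed as a `0`-`1` vector. -/
def subsetVector (K : Type) [CommRing K] {n : ℕ} (I : Finset (Fin n)) : Fin n → K :=
  fun i => if i ∈ I then 1 else 0

theorem subsetVector_eq_sum_single (K : Type) [CommRing K] {n : ℕ} (I : Finset (Fin n)) :
    subsetVector K I = ∑ i ∈ I, Pi.single i (1 : K) := by
  ext j
  simp [subsetVector, Finset.sum_apply, Pi.single_apply]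

section Coefficients

variable {A : Type} [AddCommGroup A] {n : ℕ} {P : Finset (Fin n) → Prop}

theorem span_rat_ne_top {d : Fin n → A} (hP : ∀ I, P I → ∑ i ∈ I, d i = 0) {i : Fin n}
    (hi : addOrderOf (d i) = 0) :
    Submodule.span ℚ {b | ∃ I, P I ∧ b = subsetVector ℚ I} ≠ ⊤ := by
  intro htop
  have key : ∀ v ∈ Submodule.span ℚ {b | ∃ I, P I ∧ b = subsetVector ℚ I},
      ∃ N : ℤ, N ≠ 0 ∧ ∃ w : Fin n → ℤ, (∀ j, (N : ℚ) * v j = w j) ∧ ∑ j, w j • d j = 0 := by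
    intro v hv
    induction hv using Submodule.span_induction with
    | mem v hv =>
      obtain ⟨I, hI, rfl⟩ := hv
      refine ⟨1, one_ne_zero, fun j => if j ∈ I then 1 else 0, fun j => ?_, ?_⟩
      · simp [subsetVector]
      · simpa [ite_smul] using hP I hI
    | zero => exact ⟨1, one_ne_zero, 0, by simp, by simp⟩
    | add v v' _ _ h h' =>
      obtain ⟨N, hN, w, hw, hs⟩ := h
      obtain ⟨N', hN', w', hw', hs'⟩ := h'
      refine ⟨N * N', mul_ne_zero hN hN', N' • w + N • w', fun j => ?_, ?_⟩
      · simp only [Pi.add_apply, Pi.smul_apply, smul_eq_mul]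
        push_cast
        rw [← hw, ← hw']
        ring
      · simp only [Pi.add_apply, Pi.smul_apply, add_smul, smul_assoc, Finset.sum_add_distrib,
          ← Finset.smul_sum, hs, hs', smul_zero, add_zero]
    | smul q v _ h =>
      obtain ⟨N, hN, w, hw, hs⟩ := h
      refine ⟨q.den * N, mul_ne_zero (by exact_mod_cast q.den_nz) hN, q.num • w,
        fun j => ?_, ?_⟩
      · simp only [Pi.smul_apply, smul_eq_mul]
        push_cast
        rw [← hw, ← Rat.den_mul_eq_num]
        ring
      · simp only [Pi.smul_apply, smul_assoc, ← Finset.smul_sum, hs, smul_zero]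
  obtain ⟨N, hN, w, hw, hs⟩ := key (Pi.single i 1) (htop ▸ Submodule.mem_top)
  have hw' : ∀ j, w j = (Pi.single i N : Fin n → ℤ) j := fun j => by
    have := hw j
    by_cases hj : j = i
    · subst hj
      simp only [Pi.single_eq_same, mul_one] at this ⊢
      exact_mod_cast this.symm
    · simp only [Pi.single_eq_of_ne hj, mul_zero] at this ⊢
      exact_mod_cast this.symm
  have hNd : N • d i = 0 := by
    rw [← hs, Finset.sum_eq_single i]
    · simp [hw']
    · intro j _ hj
      simp [hw', Pi.single_eq_of_ne hj]
    · simp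
  rw [← addOrderOf_dvd_iff_zsmul_eq_zero, hi] at hNd
  exact hN (by simpa using hNd)

theorem span_zmod_ne_top {d : Fin n → A} (hP : ∀ I, P I → ∑ i ∈ I, d i = 0) (hd : d ≠ 0)
    {p : ℕ} (hp : p • d = 0) :
    Submodule.span (ZMod p) {b | ∃ I, P I ∧ b = subsetVector (ZMod p) I} ≠ ⊤ := by
  intro htop
  have hpd : ∀ j, zmultiplesHom A (d j) p = 0 := fun j => by
    simpa using congrFun hp j
  let θ : Fin n → ZMod p →+ A := fun j => ZMod.lift p ⟨zmultiplesHom A (d j), hpd j⟩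
  have hθ : ∀ j, θ j 1 = d j := fun j => by
    have := ZMod.lift_coe p ⟨zmultiplesHom A (d j), hpd j⟩ 1
    simpa using this
  have key : ∀ v ∈ Submodule.span (ZMod p) {b | ∃ I, P I ∧ b = subsetVector (ZMod p) I},
      ∑ j, θ j (v j) = 0 := by
    intro v hv
    induction hv using Submodule.span_induction with
    | mem v hv =>
      obtain ⟨I, hI, rfl⟩ := hv
      simpa [subsetVector, apply_ite, hθ] using hP I hI
    | zero => simp
    | add v v' _ _ h h' => simp [Finset.sum_add_distrib, h, h']
    | smul c v _ h =>
      have hc : c • v = (c.cast : ℤ) • v := by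
        rw [← Int.cast_smul_eq_zsmul (ZMod p), ZMod.intCast_zmod_cast]
      rw [hc]
      simp only [Pi.smul_apply, map_zsmul, ← Finset.smul_sum, h, smul_zero]
  refine hd (funext fun i => ?_)
  have := key (Pi.single i 1) (htop ▸ Submodule.mem_top)
  rwa [Finset.sum_eq_single i (fun j _ hj => by simp [Pi.single_eq_of_ne hj]) (by simp),
    Pi.single_eq_same, hθ] at this

theorem exists_order_and_span_ne_top {d : Fin n → A} (hP : ∀ I, P I → ∑ i ∈ I, d i = 0)
    (hd : d ≠ 0) :
    ∃ t : ℕ, (∃ x : A, x ≠ 0 ∧ addOrderOf x = t) ∧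
      (if t = 0 then Submodule.span ℚ {b | ∃ I, P I ∧ b = subsetVector ℚ I} ≠ ⊤
        else Submodule.span (ZMod t) {b | ∃ I, P I ∧ b = subsetVector (ZMod t) I} ≠ ⊤) := by
  by_cases h : ∃ i, addOrderOf (d i) = 0
  · obtain ⟨i, hi⟩ := h
    refine ⟨0, ⟨d i, ?_, hi⟩, by simpa using span_rat_ne_top hP hi⟩
    intro h0
    simp [h0] at hi
  · push Not at h
    set N := addOrderOf d with hN
    have hN0 : N ≠ 0 := by
      have : (∏ i, addOrderOf (d i)) • d = 0 := by
        ext i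
        rw [Pi.smul_apply, Pi.zero_apply, ← addOrderOf_dvd_iff_nsmul_eq_zero]
        exact Finset.dvd_prod_of_mem _ (Finset.mem_univ i)
      rw [← addOrderOf_dvd_iff_nsmul_eq_zero] at this
      exact ne_zero_of_dvd_ne_zero (Finset.prod_ne_zero_iff.2 fun i _ => h i) this
    have hN1 : N ≠ 1 := by simpa [hN] using hd
    have hp := Nat.minFac_prime hN1
    set p := N.minFac
    obtain ⟨m, hm⟩ : p ∣ N := Nat.minFac_dvd N
    have hmd : m • d ≠ 0 := by
      rw [Ne, ← addOrderOf_dvd_iff_nsmul_eq_zero, ← hN]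
      intro hdvd
      have hm0 : 0 < m := Nat.pos_of_ne_zero (by rintro rfl; simp at hm; omega)
      have := Nat.le_of_dvd hm0 hdvd
      have := hp.two_le
      nlinarith
    have hpd : p • m • d = 0 := by
      rw [← mul_smul, ← hm, hN, addOrderOf_nsmul_eq_zero]
    obtain ⟨i, hi⟩ := Function.ne_iff.1 hmd
    have := Fact.mk hp
    refine ⟨p, ⟨(m • d) i, hi, addOrderOf_eq_prime (congrFun hpd i) hi⟩, ?_⟩
    rw [if_neg hp.ne_zero]
    refine span_zmod_ne_top (d := m • d) (fun I hI => ?_) hmd hpd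
    simp [← Finset.smul_sum, hP I hI]

theorem exists_rat_coefficients {x : A} (hx : addOrderOf x = 0)
    (h : Submodule.span ℚ {b | ∃ I, P I ∧ b = subsetVector ℚ I} ≠ ⊤) :
    ∃ d : Fin n → A, d ≠ 0 ∧ ∀ I, P I → ∑ i ∈ I, d i = 0 := by
  obtain ⟨φ, hφ, hle⟩ := Submodule.exists_le_ker_of_lt_top _ (lt_top_iff_ne_top.2 h)
  obtain ⟨N, hN⟩ := IsLocalization.exist_integer_multiples_of_finite (nonZeroDivisors ℤ)
    (fun i : Fin n => φ (Pi.single i 1))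
  choose w hw using hN
  have hN0 : (N : ℤ) ≠ 0 := nonZeroDivisors.coe_ne_zero N
  have hw' : ∀ i, (w i : ℚ) = (N : ℤ) * φ (Pi.single i 1) := fun i => by
    simpa [Submonoid.smul_def] using hw i
  refine ⟨fun i => w i • x, fun h0 => hφ ?_, fun I hI => ?_⟩
  · refine LinearMap.pi_ext' fun i => LinearMap.ext_ring ?_
    have h1 : w i • x = 0 := congrFun h0 i
    rw [← addOrderOf_dvd_iff_zsmul_eq_zero, hx] at h1
    have h2 : w i = 0 := by simpa using h1
    have h3 := hw' i
    simpa [h2, hN0] using h3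
  · have h1 : φ (subsetVector ℚ I) = 0 := hle (Submodule.subset_span ⟨I, hI, rfl⟩)
    rw [subsetVector_eq_sum_single, map_sum] at h1
    have h2 : ((∑ i ∈ I, w i : ℤ) : ℚ) = 0 := by
      push_cast
      simp only [hw', ← Finset.mul_sum, h1, mul_zero]
    rw [← Finset.sum_smul, Int.cast_eq_zero.1 h2, zero_smul]

theorem exists_zmod_coefficients {x : A} {t : ℕ} (ht : t ≠ 0) (hx : addOrderOf x = t)
    (h : Submodule.span (ZMod t) {b | ∃ I, P I ∧ b = subsetVector (ZMod t) I} ≠ ⊤) :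
    ∃ d : Fin n → A, d ≠ 0 ∧ ∀ I, P I → ∑ i ∈ I, d i = 0 := by
  set S := Submodule.span (ZMod t) {b | ∃ I, P I ∧ b = subsetVector (ZMod t) I}
  have : Nontrivial ((Fin n → ZMod t) ⧸ S) := Submodule.Quotient.nontrivial_iff.2 h
  obtain ⟨m, hm⟩ := exists_ne (0 : (Fin n → ZMod t) ⧸ S)
  obtain ⟨χ, hχ⟩ := CharacterModule.exists_character_apply_ne_zero_of_ne_zero hm
  obtain ⟨v, rfl⟩ := Submodule.mkQ_surjective S m
  set ψ : (Fin n → ZMod t) →+ AddCircle (1 : ℚ) := AddMonoidHom.comp χ S.mkQ.toAddMonoidHom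
  have hk : ∀ i, ∃ k : ℤ, ψ (Pi.single i 1) = ((k / t : ℚ) : AddCircle (1 : ℚ)) := by
    intro i
    obtain ⟨q, hq⟩ := QuotientAddGroup.mk_surjective (ψ (Pi.single i 1))
    have h0 : t • ψ (Pi.single i 1) = 0 := by
      rw [← map_nsmul]
      simp [← Pi.single_smul]
    rw [← hq] at h0
    obtain ⟨k, hk⟩ := (AddCircle.coe_eq_zero_iff (1 : ℚ) (x := t • q)).1 h0
    refine ⟨k, ?_⟩
    rw [← hq]
    congr 1
    field_simp
    simpa [mul_comm] using hk.symm
  choose k hk using hk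
  have hzero : ∀ z : ℤ, ((z / t : ℚ) : AddCircle (1 : ℚ)) = 0 ↔ z • x = 0 := by
    intro z
    have ht' : (t : ℚ) ≠ 0 := by exact_mod_cast ht
    rw [AddCircle.coe_eq_zero_iff, ← addOrderOf_dvd_iff_zsmul_eq_zero, hx]
    refine exists_congr fun c => ?_
    rw [eq_div_iff ht', eq_comm]
    constructor
    · intro h
      have : (z : ℚ) = ((t * c : ℤ) : ℚ) := by push_cast; rw [h]; simp [mul_comm]
      exact_mod_cast this
    · rintro rfl
      push_cast
      simp [mul_comm]
  refine ⟨fun i => k i • x, fun h0 => hχ ?_, fun I hI => ?_⟩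
  · change ψ v = 0
    rw [← Finset.univ_sum_single v, map_sum]
    refine Finset.sum_eq_zero fun i _ => ?_
    have h1 : (Pi.single i (v i) : Fin n → ZMod t) =
        ((v i).cast : ℤ) • (Pi.single i 1 : Fin n → ZMod t) := by
      rw [← Int.cast_smul_eq_zsmul (ZMod t), ZMod.intCast_zmod_cast, ← Pi.single_smul,
        smul_eq_mul, mul_one]
    rw [h1, map_zsmul, hk, (hzero _).2 (congrFun h0 i), smul_zero]
  · have h1 : ψ (subsetVector (ZMod t) I) = 0 := by
      have : S.mkQ (subsetVector (ZMod t) I) = 0 :=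
        (Submodule.Quotient.mk_eq_zero S).2 (Submodule.subset_span ⟨I, hI, rfl⟩)
      change χ (S.mkQ _) = 0
      rw [this, map_zero]
    rw [subsetVector_eq_sum_single, map_sum] at h1
    rw [← Finset.sum_smul, ← hzero, ← h1]
    simp only [hk]
    push_cast
    rw [Finset.sum_div]
    exact map_sum (QuotientAddGroup.mk' (AddSubgroup.zmultiples (1 : ℚ))) _ _

theorem exists_coefficients_iff :
    (∃ d : Fin n → A, d ≠ 0 ∧ ∀ I, P I → ∑ i ∈ I, d i = 0) ↔
    ∃ t : ℕ, (∃ x : A, x ≠ 0 ∧ addOrderOf x = t) ∧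
      (if t = 0 then Submodule.span ℚ {b | ∃ I, P I ∧ b = subsetVector ℚ I} ≠ ⊤
        else Submodule.span (ZMod t) {b | ∃ I, P I ∧ b = subsetVector (ZMod t) I} ≠ ⊤) := by
  constructor
  · rintro ⟨d, hd, hP⟩
    exact exists_order_and_span_ne_top hP hd
  · rintro ⟨t, ⟨x, -, hx⟩, h⟩
    split_ifs at h with ht
    · exact exists_rat_coefficients (hx.trans ht) h
    · exact exists_zmod_coefficients ht hx h

end Coefficients

namespace GroupoidData

theorem IsOpenBisection.mono {D : GroupoidData G} {U V : Set G} (hU : D.IsOpenBisection U)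
    (hVU : V ⊆ U) (hV : IsOpen V) : D.IsOpenBisection V :=
  ⟨hV, hU.2.1.mono hVU, hU.2.2.1.mono hVU, fun W hW => hU.2.2.2.1 W (hW.trans hVU),
    fun W hW => hU.2.2.2.2 W (hW.trans hVU)⟩

/-- The source map, as a map into the unit space. -/
def source (D : GroupoidData G) (g : G) : D.X := ⟨D.s g, D.s_mem g⟩

theorem continuous_source (D : GroupoidData G) : Continuous D.source :=
  D.continuous_s.subtype_mk _

theorem IsOpenBisection.source_injOn {D : GroupoidData G} {U : Set G}
    (hU : D.IsOpenBisection U) : Set.InjOn D.source U :=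
  fun _ hg _ hh h => hU.2.2.1 hg hh (congrArg Subtype.val h)

theorem IsOpenBisection.isOpen_source_image {D : GroupoidData G} {U V : Set G}
    (hU : D.IsOpenBisection U) (hVU : V ⊆ U) (hV : IsOpen V) : IsOpen (D.source '' V) := by
  have : D.source '' V = Subtype.val ⁻¹' (D.s '' V) := by
    ext x
    simp [source, Subtype.ext_iff]
  rw [this]
  exact (hU.2.2.2.2 V hVU hV).preimage continuous_subtype_val

theorem image_s_eq (D : GroupoidData G) (U : Set G) :
    D.s '' U = Subtype.val '' (D.source '' U) := by
  rw [Set.image_image]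
  rfl

theorem source_image_inter_preimage (D : GroupoidData G) {U : Set G} {W : Set D.X}
    (hW : W ⊆ D.source '' U) : D.source '' (U ∩ D.source ⁻¹' W) = W := by
  rw [Set.image_inter_preimage, Set.inter_eq_right.2 hW]

theorem IsOpenBisection.isCompact_inter_preimage {D : GroupoidData G} {U : Set G}
    (hU : D.IsOpenBisection U) {C : Set D.X} (hC : IsCompact C) (hCU : C ⊆ D.source '' U) :
    IsCompact (U ∩ D.source ⁻¹' C) := by
  have hemb : Topology.IsOpenEmbedding (U.domRestrict D.source) := by
    refine .of_continuous_injective_isOpenMap (D.continuous_source.comp continuous_subtype_val)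
      (Set.injOn_iff_injective.1 hU.source_injOn) fun V hV => ?_
    have : U.domRestrict D.source '' V = D.source '' (Subtype.val '' V) := by
      rw [Set.image_image]
      rfl
    rw [this]
    exact hU.isOpen_source_image (Subtype.coe_image_subset U V) (hU.1.isOpenMap_subtype_val V hV)
  have h := (hemb.isInducing.isCompact_preimage_iff (K := C)
    (by rwa [Set.range_domRestrict])).2 hC
  have h2 := h.image continuous_subtype_val
  convert h2 using 1
  ext g
  simp [Set.domRestrict, and_comm]

/-- Near each unit, an element of the Steinberg algebra is determined by its values on the fibre
over that unit. -/
theorem exists_eventually_eq_sum_indicator {D : GroupoidData G} [T2Space D.X] {R : Type}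
    [NonUnitalRing R] {β : G → Set G} (hβ : ∀ g, D.IsOpenBisection (β g) ∧ g ∈ β g)
    {f : G → R} (hf : f ∈ D.Steinberg R) (x : D.X) :
    ∃ F : Finset G, (∀ g, g ∈ F ↔ D.source g = x ∧ f g ≠ 0) ∧
      ∀ᶠ y in nhds x, ∀ h, D.source h = y →
        f h = ∑ g ∈ F, (β g).indicator (fun _ => f g) h := by
  classical
  have mem_β {g h : G} (hs : D.source h = D.source g) (hh : h ∈ β g) : h = g :=
    (hβ g).1.source_injOn hh (hβ g).2 hs
  suffices H : ∃ F : Finset G, (∀ g ∈ F, D.source g = x) ∧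
      ∀ᶠ y in nhds x, ∀ h, D.source h = y →
        f h = ∑ g ∈ F, (β g).indicator (fun _ => f g) h by
    obtain ⟨F, hF, hev⟩ := H
    refine ⟨F.filter (f · ≠ 0), fun g => ?_, ?_⟩
    · rw [Finset.mem_filter]
      refine ⟨fun h => ⟨hF g h.1, h.2⟩, fun h => ⟨?_, h.2⟩⟩
      have h0 := hev.self_of_nhds g h.1
      by_contra hgF
      refine h.2 (h0.trans (Finset.sum_eq_zero fun k hk => ?_))
      refine Set.indicator_of_notMem (fun hg => hgF ?_) _
      rwa [mem_β (h.1.trans (hF k hk).symm) hg]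
    · filter_upwards [hev] with y hy h hh
      rw [hy h hh, Finset.sum_filter]
      refine Finset.sum_congr rfl fun g _ => ?_
      split_ifs with h0
      · rfl
      · simp [not_not.1 h0]
  induction hf using AddSubgroup.closure_induction with
  | mem f hf =>
    obtain ⟨c, U, hUc, hU, rfl⟩ := hf
    by_cases hx : x ∈ D.source '' U
    · obtain ⟨g, hg, rfl⟩ := hx
      refine ⟨{g}, by simp, ?_⟩
      have hW : D.source '' (U ∩ β g) ∈ nhds (D.source g) :=
        (hU.isOpen_source_image Set.inter_subset_left (hU.1.inter (hβ g).1.1)).mem_nhds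
          ⟨g, ⟨hg, (hβ g).2⟩, rfl⟩
      filter_upwards [hW]
      rintro y ⟨k, ⟨hkU, hkβ⟩, rfl⟩ h hh
      have : h ∈ U ↔ h ∈ β g := by
        constructor
        · intro h'
          rwa [hU.source_injOn h' hkU hh]
        · intro h'
          rwa [(hβ g).1.source_injOn h' hkβ hh]
      simp [Set.indicator, hg, this]
    · refine ⟨∅, by simp, ?_⟩
      have hcl : IsClosed (D.source '' U) := (hUc.image D.continuous_source).isClosed
      filter_upwards [hcl.isOpen_compl.mem_nhds hx] with y hy h hh
      rw [Finset.sum_empty, Set.indicator_of_notMem]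
      rintro hhU
      exact hy ⟨h, hhU, hh⟩
  | zero => exact ⟨∅, by simp, by simp⟩
  | neg f _ ih =>
    obtain ⟨F, hF, hev⟩ := ih
    refine ⟨F, hF, ?_⟩
    filter_upwards [hev] with y hy h hh
    rw [Pi.neg_apply, hy h hh, ← Finset.sum_neg_distrib]
    refine Finset.sum_congr rfl fun g _ => ?_
    by_cases hg : h ∈ β g <;> simp [hg]
  | add f f' _ _ ih ih' =>
    obtain ⟨F, hF, hev⟩ := ih
    obtain ⟨F', hF', hev'⟩ := ih'
    have enlarge : ∀ (k : G → R) (E E' : Finset G), (∀ g ∈ E, D.source g = x) →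
        (∀ g ∈ E', D.source g = x) → E ⊆ E' →
        (∀ᶠ y in nhds x, ∀ h, D.source h = y →
          k h = ∑ g ∈ E, (β g).indicator (fun _ => k g) h) →
        (∀ᶠ y in nhds x, ∀ h, D.source h = y →
          k h = ∑ g ∈ E', (β g).indicator (fun _ => k g) h) := by
      intro k E E' hE hE' hEE hk
      filter_upwards [hk] with y hy h hh
      rw [hy h hh]
      refine Finset.sum_subset hEE fun g hg' hg => ?_
      have : k g = 0 := by
        rw [hk.self_of_nhds g (hE' g hg')]
        refine Finset.sum_eq_zero fun g' hg'' => Set.indicator_of_notMem (fun h' => hg ?_) _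
        rwa [mem_β ((hE' g hg').trans (hE g' hg'').symm) h']
      simp [this]
    have hU : ∀ g ∈ F ∪ F', D.source g = x := fun g hg =>
      (Finset.mem_union.1 hg).elim (hF g) (hF' g)
    refine ⟨F ∪ F', hU, ?_⟩
    filter_upwards [enlarge f _ _ hF hU Finset.subset_union_left hev,
      enlarge f' _ _ hF' hU Finset.subset_union_right hev'] with y hy hy' h hh
    rw [Pi.add_apply, hy h hh, hy' h hh, ← Finset.sum_add_distrib]
    refine Finset.sum_congr rfl fun g _ => ?_
    by_cases hg : h ∈ β g <;> simp [hg]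

/-- Open bisections with a common source, each having points that lie in no other of them, the set
of these points having empty interior. -/
def IsSingularFamily (D : GroupoidData G) {n : ℕ} (U : Fin n → Set G) : Prop :=
  0 < n ∧ (∀ i, D.IsOpenBisection (U i)) ∧ (∀ i j, D.s '' U i = D.s '' U j) ∧
    (∀ i, (U i \ ⋃ (j) (_ : j ≠ i), U j).Nonempty) ∧
    (∀ i, interior (U i \ ⋃ (j) (_ : j ≠ i), U j) = ∅)

/-- Some point lies in exactly the members of `U` indexed by `I`, and `I` has more than one
element. -/
def IsMeetingPattern {n : ℕ} (U : Fin n → Set G) (I : Finset (Fin n)) : Prop :=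
  1 < I.card ∧ ((⋂ i ∈ I, U i) \ ⋃ (j) (_ : j ∉ I), U j).Nonempty

theorem conditionS_iff (D : GroupoidData G) (K : Type) [CommRing K] :
    D.ConditionS K ↔ ∃ (n : ℕ) (U : Fin n → Set G), D.IsSingularFamily U ∧
      Submodule.span K {b | ∃ I, IsMeetingPattern U I ∧ b = subsetVector K I} ≠ ⊤ := by
  simp only [ConditionS, IsSingularFamily, IsMeetingPattern, and_assoc]
  rfl

theorem sum_indicator_eq {R : Type} [NonUnitalRing R] {S : Type} {n : ℕ}
    {U : Fin n → Set S} {I : Finset (Fin n)} {h : S} (hI : ∀ i, i ∈ I ↔ h ∈ U i) (d : Fin n → R) :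
    ∑ i, (U i).indicator (fun _ => d i) h = ∑ i ∈ I, d i := by
  classical
  simp only [Set.indicator, ← hI, Finset.sum_ite_mem, Finset.univ_inter]

theorem exists_isSingularFamily {D : GroupoidData G} [T2Space D.X] (hetale : D.IsEtale)
    {R : Type} [NonUnitalRing R] {f : G → R} (hf : f ∈ D.Steinberg R) (hf0 : f ≠ 0)
    (hint : interior {g | f g ≠ 0} = ∅) :
    ∃ (n : ℕ) (U : Fin n → Set G), D.IsSingularFamily U ∧
      ∃ d : Fin n → R, d ≠ 0 ∧ ∀ I, IsMeetingPattern U I → ∑ i ∈ I, d i = 0 := by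
  classical
  choose β hβ using hetale
  choose F hF hev using exists_eventually_eq_sum_indicator hβ hf
  obtain ⟨g₀, hg₀⟩ := Function.ne_iff.1 hf0
  obtain ⟨x, ⟨g₁, hg₁⟩, hmin⟩ := (measure fun x => (F x).card).wf.has_min
    {x | (F x).Nonempty} ⟨D.source g₀, g₀, (hF _ _).2 ⟨rfl, hg₀⟩⟩
  have hsub : ∀ᶠ y in nhds x, ∀ g ∈ F x, y ∈ D.source '' β g := by
    rw [Filter.eventually_all_finset]
    intro g hg
    exact ((hβ g).1.isOpen_source_image subset_rfl (hβ g).1.1).mem_nhds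
      ⟨g, (hβ g).2, ((hF x g).1 hg).1⟩
  obtain ⟨W, hW, hWo, hxW⟩ := eventually_nhds_iff.1 ((hev x).and hsub)
  set e := (F x).equivFin.symm
  have hsrc : ∀ i, D.source (e i) = x := fun i => ((hF x _).1 (e i).2).1
  set U : Fin (F x).card → Set G := fun i => β (e i) ∩ D.source ⁻¹' W with hUdef
  have hU : ∀ i, D.IsOpenBisection (U i) := fun i =>
    (hβ (e i)).1.mono Set.inter_subset_left
      ((hβ (e i)).1.1.inter (hWo.preimage D.continuous_source))
  have hUW : ∀ i, D.source '' U i = W := fun i =>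
    D.source_image_inter_preimage fun y hy => (hW y hy).2 _ (e i).2
  have hself : ∀ i, (e i : G) ∈ U i := fun i => ⟨(hβ _).2, by simpa [hsrc] using hxW⟩
  have hfW : ∀ h, D.source h ∈ W → f h = ∑ i, (U i).indicator (fun _ => f (e i)) h := by
    intro h hh
    rw [(hW _ hh).1 h rfl, ← Finset.sum_coe_sort, ← e.sum_comp]
    refine Finset.sum_congr rfl fun i _ => ?_
    simp [Set.indicator, hUdef, hh]
  have hmem : ∀ i {h}, h ∈ U i → D.source h ∈ W := fun i h hh => hh.2
  have hexcl : ∀ i, U i \ ⋃ (j) (_ : j ≠ i), U j ⊆ {g | f g ≠ 0} := by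
    rintro i h ⟨hi, hj⟩
    simp only [Set.mem_iUnion, not_exists] at hj
    have hI : ∀ j, j ∈ ({i} : Finset (Fin (F x).card)) ↔ h ∈ U j := fun j => by
      rw [Finset.mem_singleton]
      exact ⟨fun h => h ▸ hi, fun h => by_contra fun hne => hj j hne h⟩
    rw [Set.mem_ofPred_eq, hfW h (hmem i hi), sum_indicator_eq hI, Finset.sum_singleton]
    exact ((hF x _).1 (e i).2).2
  refine ⟨_, U, ⟨Finset.card_pos.2 ⟨g₁, hg₁⟩, hU, fun i j => ?_, fun i => ⟨e i, hself i, ?_⟩,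
    fun i => ?_⟩, fun i => f (e i), fun h0 => ?_, ?_⟩
  · rw [image_s_eq, image_s_eq, hUW, hUW]
  · simp only [Set.mem_iUnion, not_exists]
    intro j hj hij
    refine hj (e.injective (Subtype.ext ?_))
    exact (hU j).source_injOn (hself j) hij (by rw [hsrc, hsrc])
  · exact Set.subset_eq_empty (interior_mono (hexcl i)) hint
  · have := congrFun h0 (e.symm ⟨g₁, hg₁⟩)
    simp only [Equiv.apply_symm_apply] at this
    exact ((hF x g₁).1 hg₁).2 this
  · rintro I ⟨hI, h, hhI, hhJ⟩
    simp only [Set.mem_iInter, Set.mem_iUnion, not_exists] at hhI hhJ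
    obtain ⟨a, ha, b, hb, hab⟩ := Finset.one_lt_card.1 hI
    have hhW := hmem a (hhI a ha)
    rw [← sum_indicator_eq (h := h) (U := U)
      fun i => ⟨hhI i, fun hi => by_contra fun h' => hhJ i h' hi⟩, ← hfW h hhW]
    by_contra hfh
    refine hmin (D.source h) ⟨h, (hF _ _).2 ⟨rfl, hfh⟩⟩ ?_
    change (F (D.source h)).card < (F x).card
    have hpt : ∀ i, ∃ k ∈ U i, D.source k = D.source h := fun i => by
      rw [← hUW i] at hhW
      exact hhW
    choose φ hφU hφ using hpt
    have hφI : ∀ i ∈ I, φ i = h := fun i hi => (hU i).source_injOn (hφU i) (hhI i hi) (hφ i)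
    have himage : F (D.source h) ⊆ Finset.univ.image φ := by
      intro k hk
      obtain ⟨hks, hfk⟩ := (hF _ _).1 hk
      rw [hfW k (hks ▸ hhW)] at hfk
      obtain ⟨i, -, hi⟩ := Finset.exists_ne_zero_of_sum_ne_zero hfk
      exact Finset.mem_image.2 ⟨i, Finset.mem_univ i,
        (hU i).source_injOn (hφU i) (Set.mem_of_indicator_ne_zero hi) ((hφ i).trans hks.symm)⟩
    refine (Finset.card_le_card himage).trans_lt ?_
    refine lt_of_le_of_ne (by simpa using Finset.card_image_le (s := Finset.univ) (f := φ)) ?_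
    intro hcard
    refine hab (Finset.card_image_iff.1 (hcard.trans (by simp))
      (Finset.mem_coe.2 (Finset.mem_univ a))
      (Finset.mem_coe.2 (Finset.mem_univ b)) ((hφI a ha).trans (hφI b hb).symm))

theorem exists_singular_element [LocallyCompactSpace G] {D : GroupoidData G} [T2Space D.X]
    [TotallyDisconnectedSpace D.X] (hXopen : IsOpen D.X) {R : Type} [NonUnitalRing R] {n : ℕ}
    {U : Fin n → Set G} (hU : D.IsSingularFamily U) {d : Fin n → R} (hd : d ≠ 0)
    (hsum : ∀ I, IsMeetingPattern U I → ∑ i ∈ I, d i = 0) :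
    ∃ f : G → R, f ∈ D.Steinberg R ∧ f ≠ 0 ∧ interior {g | f g ≠ 0} = ∅ := by
  classical
  obtain ⟨-, hbis, hs, hne, hint⟩ := hU
  obtain ⟨i₀, hi₀⟩ := Function.ne_iff.1 hd
  obtain ⟨g, hg, hg'⟩ := hne i₀
  have hsrc : ∀ i j, D.source '' U i = D.source '' U j := fun i j =>
    Subtype.val_injective.image_injective (by rw [← image_s_eq, ← image_s_eq, hs])
  have : LocallyCompactSpace D.X := hXopen.locallyCompactSpace
  obtain ⟨K, hK, hgK, hKU⟩ := exists_compact_subset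
    ((hbis i₀).isOpen_source_image subset_rfl (hbis i₀).1) ⟨g, hg, rfl⟩
  obtain ⟨C, hC, hgC, hCK⟩ := loc_compact_Haus_tot_disc_of_zero_dim.exists_subset_of_mem_open
    hgK isOpen_interior
  have hCK' : C ⊆ K := hCK.trans interior_subset
  have hCc : IsCompact C := hK.of_isClosed_subset hC.1 hCK'
  set V : Fin n → Set G := fun i => U i ∩ D.source ⁻¹' C with hV
  have hVo : ∀ i, IsOpen (V i) := fun i => (hbis i).1.inter (hC.2.preimage D.continuous_source)
  set f : G → R := ∑ i, (V i).indicator (fun _ => d i) with hf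
  have hfapp : ∀ h, f h = ∑ i, (V i).indicator (fun _ => d i) h := fun h => by
    rw [hf, Finset.sum_apply]
  refine ⟨f, sum_mem fun i _ => AddSubgroup.subset_closure ⟨d i, V i, ?_, ?_, rfl⟩,
    fun h0 => hi₀ ?_, ?_⟩
  · exact (hbis i).isCompact_inter_preimage hCc (hCK'.trans (hKU.trans (hsrc i₀ i).subset))
  · exact (hbis i).mono Set.inter_subset_left (hVo i)
  · have h1 := congrFun h0 g
    simp only [Set.mem_iUnion, not_exists] at hg'
    have hI : ∀ j, j ∈ ({i₀} : Finset (Fin n)) ↔ g ∈ V j := fun j => by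
      rw [Finset.mem_singleton]
      exact ⟨fun h => h ▸ ⟨hg, hgC⟩, fun h => by_contra fun hne => hg' j hne h.1⟩
    rwa [hfapp, sum_indicator_eq hI, Finset.sum_singleton] at h1
  · rw [Set.eq_empty_iff_forall_notMem]
    intro h hh
    have hfh : f h ≠ 0 := interior_subset hh
    rw [hfapp] at hfh
    obtain ⟨i, -, hi⟩ := Finset.exists_ne_zero_of_sum_ne_zero hfh
    have hhV := Set.mem_of_indicator_ne_zero hi
    refine (hint i).subset (mem_interior.2
      ⟨interior {g | f g ≠ 0} ∩ V i, ?_, isOpen_interior.inter (hVo i), hh, hhV⟩)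
    rintro k ⟨hk, hkU, hkC⟩
    refine ⟨hkU, fun hkj => ?_⟩
    simp only [Set.mem_iUnion] at hkj
    obtain ⟨j, hji, hkj⟩ := hkj
    refine (interior_subset hk : f k ≠ 0) ?_
    rw [hfapp, sum_indicator_eq (I := Finset.univ.filter (k ∈ U ·)) (by simp [hV, hkC])]
    refine hsum _ ⟨Finset.one_lt_card.2 ⟨j, by simpa, i, by simpa, hji⟩, k, ?_, ?_⟩ <;> simp

theorem exists_singular_element_iff [LocallyCompactSpace G] {D : GroupoidData G} [T2Space D.X]
    [TotallyDisconnectedSpace D.X] (hXopen : IsOpen D.X) (hetale : D.IsEtale) (R : Type)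
    [NonUnitalRing R] :
    (∃ f : G → R, f ∈ D.Steinberg R ∧ f ≠ 0 ∧ interior {g | f g ≠ 0} = ∅) ↔
      ∃ (n : ℕ) (U : Fin n → Set G), D.IsSingularFamily U ∧
        ∃ d : Fin n → R, d ≠ 0 ∧ ∀ I, IsMeetingPattern U I → ∑ i ∈ I, d i = 0 := by
  constructor
  · rintro ⟨f, hf, hf0, hint⟩
    exact exists_isSingularFamily hetale hf hf0 hint
  · rintro ⟨n, U, hU, d, hd, hsum⟩
    exact exists_singular_element hXopen hU hd hsum

end GroupoidData

/-- Let `G` be a non-Hausdorff ample groupoid and `R` a ring.  The singular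
ideal `J_R = {f ∈ RG : supp°(f) has empty interior}` of the Steinberg algebra `RG` is nonzero
if and only if there exists `t ∈ ord(R)` (the set of additive orders of nonzero elements of
`R`, with order `0` meaning infinite order) such that `G` satisfies condition `(𝒮_t)`,
where `(𝒮₀)` is taken with coefficients `ℚ` and `(𝒮_t)` with coefficients `ℤ/tℤ` for `t > 1`. -/
theorem stmt14 [LocallyCompactSpace G] (D : GroupoidData G) [T2Space ↥D.X]
    [TotallyDisconnectedSpace ↥D.X] (hXopen : IsOpen D.X) (hetale : D.IsEtale)
    (hnH : ¬ T2Space G) (R : Type) [NonUnitalRing R] :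
    (∃ f : G → R, f ∈ D.Steinberg R ∧ f ≠ 0 ∧ interior {g : G | f g ≠ 0} = ∅) ↔
      ∃ t : ℕ, (∃ x : R, x ≠ 0 ∧ addOrderOf x = t) ∧
        (if t = 0 then D.ConditionS ℚ else D.ConditionS (ZMod t)) := by
  simp only [GroupoidData.exists_singular_element_iff hXopen hetale,
    GroupoidData.conditionS_iff, exists_coefficients_iff]
  constructor
  · rintro ⟨n, U, hU, t, hx, h⟩
    refine ⟨t, hx, ?_⟩
    split_ifs at h ⊢ <;> exact ⟨n, U, hU, h⟩
  · rintro ⟨t, hx, h⟩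
    split_ifs at h with ht <;> obtain ⟨n, U, hU, h⟩ := h <;>
      exact ⟨n, U, hU, t, hx, by simpa [ht] using h⟩
end

section
/- Let G be a non-Hausdorff étale groupoid such that for every unit x, the set X̄(x) := X̄ ∩ G_x^x is finite, where X̄ is the closure of the unit space X in G. If J ∩ 𝒞_c(G) = {0}, then the singular ideal J of C*_r(G) is zero. -/
variable {G : Type} [TopologicalSpace G]

section

open Topology Filter Set
open scoped Pointwise

theorem List.exists_eq_append_of_not_nodup {α : Type*} {l : List α} (h : ¬ l.Nodup) :
    ∃ a u v w, l = u ++ a :: (v ++ a :: w) := by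
  induction l with
  | nil => simp at h
  | cons b l ih =>
    by_cases hb : b ∈ l
    · obtain ⟨v, w, rfl⟩ := List.append_of_mem hb
      exact ⟨b, [], v, w, rfl⟩
    · have hl : ¬ l.Nodup := fun hl => h (List.nodup_cons.2 ⟨hb, hl⟩)
      obtain ⟨a, u, v, w, rfl⟩ := ih hl
      exact ⟨a, b :: u, v, w, rfl⟩

theorem Set.list_prod_mem_pow {M : Type*} [Monoid M] {F : Set M} (l : List M)
    (hl : ∀ a ∈ l, a ∈ F) : l.prod ∈ F ^ l.length := by
  induction l with
  | nil => simp
  | cons a l ih =>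
    rw [List.prod_cons, List.length_cons, pow_succ']
    exact mul_mem_mul (hl a (by simp)) (ih fun b hb => hl b (by simp [hb]))

/-- A form of Dietzmann's lemma: the powers of a finite subset of a group which is closed under
squaring and conjugation by its own elements stabilize. -/
theorem Set.Finite.pow_ncard_succ_subset {Γ : Type*} [Group Γ] {F : Set Γ} (hF : F.Finite)
    (hsq : ∀ a ∈ F, a * a ∈ F) (hconj : ∀ a ∈ F, ∀ b ∈ F, a⁻¹ * b * a ∈ F) :
    F ^ (F.ncard + 1) ⊆ F ^ F.ncard := by
  intro p hp
  obtain ⟨q, rfl⟩ := Set.mem_pow.1 hp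
  set l : List Γ := List.ofFn fun i => (q i : Γ) with hl
  have hlen : l.length = F.ncard + 1 := by simp [hl]
  have hlF : ∀ a ∈ l, a ∈ F := by
    intro a ha
    obtain ⟨i, rfl⟩ := (List.mem_ofFn' _ _).1 ha
    exact (q i).2
  have hdup : ¬ l.Nodup := by
    classical
    intro hnd
    have h1 : l.toFinset ⊆ hF.toFinset := fun a ha => by simpa using hlF a (by simpa using ha)
    have h2 := Finset.card_le_card h1
    rw [List.toFinset_card_of_nodup hnd, hlen, ← Set.ncard_eq_toFinset_card F hF] at h2
    omega
  obtain ⟨a, u, v, w, huvw⟩ := List.exists_eq_append_of_not_nodup hdup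
  rw [huvw] at hlF hlen ⊢
  have ha : a ∈ F := hlF a (by simp)
  have hprod : (u ++ a :: (v ++ a :: w)).prod
      = (u ++ (a * a) :: (v.map (MulAut.conj a⁻¹) ++ w)).prod := by
    have : (v.map (MulAut.conj a⁻¹)).prod = a⁻¹ * v.prod * a := by
      rw [← map_list_prod]; simp
    simp only [List.prod_append, List.prod_cons, this]
    group
  have hlen' : (u ++ (a * a) :: (v.map (MulAut.conj a⁻¹) ++ w)).length = F.ncard := by
    simp at hlen ⊢; omega
  rw [hprod, ← hlen']
  refine Set.list_prod_mem_pow _ fun b hb => ?_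
  simp only [List.mem_append, List.mem_cons, List.mem_map] at hb
  rcases hb with hb | rfl | ⟨c, hc, rfl⟩ | hb
  · exact hlF b (by simp [hb])
  · exact hsq a ha
  · simpa using hconj a ha c (hlF c (by simp [hc]))
  · exact hlF b (by simp [hb])

namespace GroupoidData

variable (D : GroupoidData G)

/-- The isotropy group at a unit. -/
def Isotropy (x : D.X) : Type := {g : G // D.r g = x ∧ D.s g = x}

instance (x : D.X) : Mul (D.Isotropy x) :=
  ⟨fun a b => ⟨D.mul a.1 b.1, by
    have h : D.s a.1 = D.r b.1 := a.2.2.trans b.2.1.symm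
    exact ⟨(D.r_mul _ _ h).trans a.2.1, (D.s_mul _ _ h).trans b.2.2⟩⟩⟩

instance (x : D.X) : One (D.Isotropy x) := ⟨⟨x, D.r_unit _ x.2, D.s_unit _ x.2⟩⟩

instance (x : D.X) : Inv (D.Isotropy x) :=
  ⟨fun a => ⟨D.inv a.1, (D.r_inv _).trans a.2.2, (D.s_inv _).trans a.2.1⟩⟩

instance (x : D.X) : Group (D.Isotropy x) :=
  Group.ofLeftAxioms
    (fun a b c => Subtype.ext (D.mul_assoc _ _ _ (a.2.2.trans b.2.1.symm) (b.2.2.trans c.2.1.symm)))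
    (fun a => Subtype.ext (by
      have := D.unit_mul a.1
      rwa [a.2.1] at this))
    (fun a => Subtype.ext ((D.inv_mul a.1).trans a.2.2))

variable {D}

theorem tendsto_mul {ι : Type*} {l : Filter ι} {a b : ι → G} {g h : G}
    (ha : Tendsto a l (𝓝 g)) (hb : Tendsto b l (𝓝 h)) (hgh : D.s g = D.r h)
    (hab : ∀ᶠ i in l, D.s (a i) = D.r (b i)) :
    Tendsto (fun i => D.mul (a i) (b i)) l (𝓝 (D.mul g h)) := by
  have hc : ContinuousWithinAt (fun p : G × G => D.mul p.1 p.2)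
      {p : G × G | D.s p.1 = D.r p.2} (g, h) := D.continuousOn_mul (g, h) hgh
  exact hc.tendsto.comp (tendsto_nhdsWithin_iff.2 ⟨ha.prodMk_nhds hb, hab⟩)

theorem s_eq_of_tendsto [T2Space D.X] {ι : Type*} {l : Filter ι} [l.NeBot] {a : ι → G} {g h : G}
    (hg : Tendsto a l (𝓝 g)) (hh : Tendsto a l (𝓝 h)) : D.s g = D.s h := by
  have hc : Continuous (fun g => (⟨D.s g, D.s_mem g⟩ : D.X)) := D.continuous_s.subtype_mk _
  exact congrArg Subtype.val
    (tendsto_nhds_unique ((hc.tendsto g).comp hg) ((hc.tendsto h).comp hh))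

theorem r_eq_of_tendsto [T2Space D.X] {ι : Type*} {l : Filter ι} [l.NeBot] {a : ι → G} {g h : G}
    (hg : Tendsto a l (𝓝 g)) (hh : Tendsto a l (𝓝 h)) : D.r g = D.r h := by
  rw [← D.s_inv, ← D.s_inv]
  exact s_eq_of_tendsto ((D.continuous_inv.tendsto g).comp hg) ((D.continuous_inv.tendsto h).comp hh)

theorem IsEtale.image_s_mem_nhds (hD : D.IsEtale) {g : G} {A : Set G} (hA : A ∈ 𝓝 g) :
    D.s '' A ∈ 𝓝 (D.s g) := by
  obtain ⟨U, hU, hgU⟩ := hD g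
  obtain ⟨B, hBA, hB, hgB⟩ := mem_nhds_iff.1 hA
  exact mem_of_superset ((hU.2.2.2.2 (B ∩ U) inter_subset_right (hB.inter hU.1)).mem_nhds
    (mem_image_of_mem _ ⟨hgB, hgU⟩)) (image_mono (inter_subset_left.trans hBA))

/-- The points of the closure of the unit space lying in the isotropy group at `x`. -/
def closureFiber (D : GroupoidData G) (x : D.X) : Set (D.Isotropy x) := {g | g.1 ∈ closure D.X}

theorem one_mem_closureFiber (x : D.X) : 1 ∈ D.closureFiber x := subset_closure x.2

theorem sq_mem_closureFiber {x : D.X} {g : D.Isotropy x} (hg : g ∈ D.closureFiber x) :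
    g * g ∈ D.closureFiber x := by
  have hne : (𝓝[D.X] g.1).NeBot := mem_closure_iff_nhdsWithin_neBot.1 hg
  have ht : Tendsto id (𝓝[D.X] g.1) (𝓝 g.1) := tendsto_id.mono_left nhdsWithin_le_nhds
  have hX : ∀ᶠ y in 𝓝[D.X] g.1, y ∈ D.X := self_mem_nhdsWithin
  refine mem_closure_of_tendsto (tendsto_mul ht ht (g.2.2.trans g.2.1.symm) ?_) ?_
  · filter_upwards [hX] with y hy
    simp [D.s_unit y hy, D.r_unit y hy]
  · filter_upwards [hX] with y hy
    have := D.mul_unit y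
    rw [D.s_unit y hy] at this
    simpa [this] using hy

theorem IsEtale.conj_mem_closureFiber (hD : D.IsEtale) {x : D.X} (a : D.Isotropy x)
    {g : D.Isotropy x} (hg : g ∈ D.closureFiber x) : a * g * a⁻¹ ∈ D.closureFiber x := by
  have hne : (𝓝[D.X] g.1).NeBot := mem_closure_iff_nhdsWithin_neBot.1 hg
  have hX : ∀ᶠ y in 𝓝[D.X] g.1, y ∈ D.X := self_mem_nhdsWithin
  have hle : Tendsto id (𝓝[D.X] g.1) (𝓝 (D.s a.1)) := by
    have h1 : Tendsto D.s (𝓝[D.X] g.1) (𝓝 (D.s g.1)) :=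
      (D.continuous_s.tendsto _).mono_left nhdsWithin_le_nhds
    rw [show D.s g.1 = D.s a.1 from g.2.2.trans a.2.2.symm] at h1
    refine h1.congr' ?_
    filter_upwards [hX] with y hy using D.s_unit y hy
  let L : Filter G := 𝓝 a.1 ⊓ comap D.s (𝓝[D.X] g.1)
  have hL : L.NeBot := by
    rw [Filter.inf_neBot_iff]
    rintro A hA B ⟨C, hC, hCB⟩
    obtain ⟨_, ⟨b, hb, rfl⟩, hbC⟩ :=
      hne.nonempty_of_mem (inter_mem (hle (hD.image_s_mem_nhds hA)) hC)
    exact ⟨b, hb, hCB hbC⟩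
  have ha : Tendsto id L (𝓝 a.1) := tendsto_id.mono_left inf_le_left
  have hs' : Tendsto D.s L (𝓝[D.X] g.1) := tendsto_comap.mono_left inf_le_right
  have hs : Tendsto D.s L (𝓝 g.1) := hs'.mono_right nhdsWithin_le_nhds
  have hinv : Tendsto D.inv L (𝓝 (D.inv a.1)) :=
    ((D.continuous_inv.tendsto _).comp ha)
  have hag : D.s a.1 = D.r g.1 := a.2.2.trans g.2.1.symm
  have h1 := tendsto_mul ha hs hag
    (Eventually.of_forall fun b => (D.r_unit _ (D.s_mem b)).symm)
  have h2 := tendsto_mul h1 hinv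
    (((D.s_mul _ _ hag).trans g.2.2).trans ((D.r_inv _).trans a.2.2).symm)
    (Eventually.of_forall fun b => by simp [D.mul_unit, D.r_inv])
  refine mem_closure_of_tendsto h2 (Eventually.of_forall fun b => ?_)
  simpa [D.mul_unit, D.mul_inv] using D.r_mem b

theorem mul_inv_mem_closure_of_not_disjoint [T2Space D.X] {g h : G}
    (hgh : ¬ Disjoint (𝓝 g) (𝓝 h)) :
    D.r g = D.r h ∧ D.s g = D.s h ∧ D.mul g (D.inv h) ∈ closure D.X := by
  have hne : (𝓝 g ⊓ 𝓝 h).NeBot := by rwa [neBot_iff, Ne, ← disjoint_iff]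
  have hg : Tendsto id (𝓝 g ⊓ 𝓝 h) (𝓝 g) := tendsto_id.mono_left inf_le_left
  have hh : Tendsto id (𝓝 g ⊓ 𝓝 h) (𝓝 h) := tendsto_id.mono_left inf_le_right
  have hs : D.s g = D.s h := s_eq_of_tendsto hg hh
  refine ⟨r_eq_of_tendsto hg hh, hs, ?_⟩
  have := tendsto_mul hg ((D.continuous_inv.tendsto h).comp hh) (hs.trans (D.r_inv h).symm)
    (Eventually.of_forall fun b => by simp [D.r_inv])
  refine mem_closure_of_tendsto this (Eventually.of_forall fun b => ?_)
  simpa [D.mul_inv] using D.r_mem b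

/-- If the fibers of the closure of the unit space are finite, every element of the groupoid lies
in a finite set of elements with the same source which is closed under non-separation. -/
theorem IsEtale.exists_finite_saturated [T2Space D.X] (hD : D.IsEtale)
    (hfin : ∀ x ∈ D.X, {g : G | g ∈ closure D.X ∧ D.r g = x ∧ D.s g = x}.Finite) (g₀ : G) :
    ∃ T : Finset G, g₀ ∈ T ∧ (∀ g ∈ T, D.s g = D.s g₀) ∧
      ∀ g ∈ T, ∀ h, ¬ Disjoint (𝓝 h) (𝓝 g) → h ∈ T := by
  classical
  let x : D.X := ⟨D.r g₀, D.r_mem g₀⟩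
  have hF : (D.closureFiber x).Finite := by
    refine Set.Finite.of_finite_image (f := Subtype.val) ((hfin x x.2).subset ?_)
      Subtype.val_injective.injOn
    rintro _ ⟨g, hg, rfl⟩
    exact ⟨hg, g.2⟩
  set F := D.closureFiber x
  have hstab : F ^ (F.ncard + 1) ⊆ F ^ F.ncard :=
    hF.pow_ncard_succ_subset (fun a ha => sq_mem_closureFiber ha)
      (fun a _ b hb => by simpa using hD.conj_mem_closureFiber a⁻¹ hb)
  have hN : (F ^ F.ncard).Finite := by
    induction F.ncard with
    | zero => simp
    | succ n ih => exact pow_succ F n ▸ ih.mul hF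
  have hmem : ∀ g, g ∈ (hN.image fun n : D.Isotropy x => D.mul n.1 g₀).toFinset ↔
      ∃ n ∈ F ^ F.ncard, D.mul n.1 g₀ = g := by
    intro g; simp
  refine ⟨(hN.image fun n => D.mul n.1 g₀).toFinset, ?_, ?_, ?_⟩
  · exact (hmem _).2 ⟨1, Set.one_mem_pow (one_mem_closureFiber x), D.unit_mul g₀⟩
  · intro g hg
    obtain ⟨n, -, rfl⟩ := (hmem _).1 hg
    exact D.s_mul _ _ n.2.2
  · intro g hg h hh
    obtain ⟨n, hn, rfl⟩ := (hmem _).1 hg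
    set g := D.mul n.1 g₀
    obtain ⟨hr, hs, hcl⟩ := mul_inv_mem_closure_of_not_disjoint (D := D) hh
    have hrg : D.r g = x := (D.r_mul _ _ n.2.2).trans n.2.1
    have hcomp : D.s h = D.r (D.inv g) := hs.trans (D.r_inv g).symm
    let η : D.Isotropy x := ⟨D.mul h (D.inv g), (D.r_mul _ _ hcomp).trans (hr.trans hrg),
      (D.s_mul _ _ hcomp).trans ((D.s_inv g).trans hrg)⟩
    refine (hmem _).2 ⟨η * n, hstab ?_, ?_⟩
    · rw [pow_succ']
      exact Set.mul_mem_mul hcl hn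
    · calc D.mul (D.mul η.1 n.1) g₀ = D.mul η.1 g :=
            D.mul_assoc _ _ _ (η.2.2.trans n.2.1.symm) n.2.2
        _ = D.mul h (D.mul (D.inv g) g) := D.mul_assoc _ _ _ hcomp (D.s_inv g)
        _ = h := by rw [D.inv_mul, ← hs, D.mul_unit]

theorem IsOpenBisection.eventually_exists_s_eq {U A : Set G} {g d : G} (hU : D.IsOpenBisection U)
    (hd : d ∈ U) (hA : A ∈ 𝓝 d) (hs : D.s g = D.s d) : ∀ᶠ y in 𝓝 g, ∃ a ∈ A ∩ U, D.s a = D.s y := by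
  obtain ⟨B, hBA, hB, hdB⟩ := mem_nhds_iff.1 hA
  have h1 : D.s '' (B ∩ U) ∈ 𝓝 (D.s g) := by
    rw [hs]
    exact (hU.2.2.2.2 _ inter_subset_right (hB.inter hU.1)).mem_nhds ⟨d, ⟨hdB, hd⟩, rfl⟩
  filter_upwards [D.continuous_s.tendsto g h1] with y hy
  obtain ⟨a, ha, hay⟩ := hy
  exact ⟨a, ⟨hBA ha.1, ha.2⟩, hay⟩

open Classical in
/-- Near a finite saturated set `T`, a function in `𝒞_c(G)` is asymptotically a combination of
indicator functions of bisections. -/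
theorem tendsto_sub_sum_of_mem_CcSpan {T : Finset G} {V : G → Set G}
    (hV : ∀ d ∈ T, D.IsOpenBisection (V d) ∧ d ∈ V d)
    (hs : ∀ g ∈ T, ∀ h ∈ T, D.s g = D.s h)
    (hT : ∀ g ∈ T, ∀ h, ¬ Disjoint (𝓝 h) (𝓝 g) → h ∈ T)
    {f : G → ℂ} (hf : f ∈ D.CcSpan) {g : G} (hg : g ∈ T) :
    Tendsto (fun y => f y - ∑ d ∈ T, if y ∈ V d then f d else 0) (𝓝 g) (𝓝 0) := by
  induction hf using Submodule.span_induction with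
  | zero => simp
  | add a b _ _ ha hb =>
    refine (by simpa using ha.add hb : Tendsto _ _ (𝓝 (0 : ℂ))).congr fun y => ?_
    have : (∑ d ∈ T, if y ∈ V d then (a + b) d else 0)
        = (∑ d ∈ T, if y ∈ V d then a d else 0) + ∑ d ∈ T, if y ∈ V d then b d else 0 := by
      rw [← Finset.sum_add_distrib]
      exact Finset.sum_congr rfl fun d _ => by split_ifs <;> simp
    rw [this, Pi.add_apply]
    ring
  | smul c a _ ha =>
    refine (by simpa using ha.const_mul c : Tendsto _ _ (𝓝 (0 : ℂ))).congr fun y => ?_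
    simp [mul_sub, Finset.mul_sum]
  | mem f hf =>
    obtain ⟨U, hU, hcont, hzero, K, hK, hKU, hsupp⟩ := hf
    by_cases hTU : ∃ d ∈ T, d ∈ U
    · obtain ⟨d, hd, hdU⟩ := hTU
      have hsum : ∀ y, (∑ e ∈ T, if y ∈ V e then f e else 0) = if y ∈ V d then f d else 0 := by
        intro y
        refine Finset.sum_eq_single_of_mem d hd fun e he hed => ?_
        have : e ∉ U := fun heU => hed (hU.2.2.1 heU hdU (hs e he d hd))
        simp [hzero e this]
      simp only [hsum]
      rw [Metric.tendsto_nhds]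
      intro ε hε
      have hA : {y | dist (f y) (f d) < ε} ∈ 𝓝 d :=
        (hcont.continuousAt (hU.1.mem_nhds hdU)).eventually (Metric.ball_mem_nhds _ hε)
      filter_upwards [hU.eventually_exists_s_eq hdU
        (inter_mem hA ((hV d hd).1.1.mem_nhds (hV d hd).2)) (hs g hg d hd)] with y hy
      obtain ⟨a, ⟨⟨haA, haV⟩, haU⟩, hay⟩ := hy
      by_cases hya : y = a
      · subst hya
        rw [if_pos haV, dist_zero_right, ← dist_eq_norm]
        exact haA
      · have hyU : y ∉ U := fun h => hya (hU.2.2.1 h haU hay.symm)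
        have hyV : y ∉ V d := fun h => hya ((hV d hd).1.2.2.1 h haV hay.symm)
        simpa [hzero y hyU, hyV] using hε
    · have hsum : ∀ y, (∑ e ∈ T, if y ∈ V e then f e else 0) = 0 := fun y =>
        Finset.sum_eq_zero fun e he => by simp [hzero e fun h => hTU ⟨e, he, h⟩]
      simp only [hsum, sub_zero]
      have hev : ∀ᶠ y in 𝓝 g, f y = 0 := by
        by_contra hfr
        have hfr' : ∃ᶠ y in 𝓝 g, f y ≠ 0 := not_eventually.1 hfr
        have hne : (𝓝 g ⊓ 𝓟 {y | f y ≠ 0}).NeBot := frequently_iff_neBot.1 hfr'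
        obtain ⟨e, heK, he⟩ := hK (f := 𝓝 g ⊓ 𝓟 {y | f y ≠ 0})
          (inf_le_right.trans (principal_mono.2 hsupp))
        refine hTU ⟨e, hT g hg e fun hdisj => ?_, hKU heK⟩
        exact he.neBot.ne (le_bot_iff.1
          ((inf_le_inf_left _ inf_le_left).trans (disjoint_iff.1 hdisj).le))
      exact (tendsto_congr' hev).2 tendsto_const_nhds

open Classical in
theorem tendsto_sub_sum_of_uniform_limit {T : Finset G} {V : G → Set G}
    (hV : ∀ d ∈ T, D.IsOpenBisection (V d) ∧ d ∈ V d)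
    (hs : ∀ g ∈ T, ∀ h ∈ T, D.s g = D.s h)
    (hT : ∀ g ∈ T, ∀ h, ¬ Disjoint (𝓝 h) (𝓝 g) → h ∈ T)
    {f : G → ℂ} (hf : ∀ ε : ℝ, 0 < ε → ∃ h ∈ D.CcSpan, ∀ g : G, ‖f g - h g‖ ≤ ε)
    {g : G} (hg : g ∈ T) :
    Tendsto (fun y => f y - ∑ d ∈ T, if y ∈ V d then f d else 0) (𝓝 g) (𝓝 0) := by
  rw [Metric.tendsto_nhds]
  intro ε hε
  obtain ⟨h, hh, hfh⟩ := hf (ε / (T.card + 2)) (by positivity)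
  set η := ε / (T.card + 2) with hη
  have hη0 : 0 < η := by positivity
  filter_upwards [Metric.tendsto_nhds.1 (tendsto_sub_sum_of_mem_CcSpan hV hs hT hh hg) η hη0]
    with y hy
  rw [dist_zero_right] at hy ⊢
  have hsum : ‖(∑ d ∈ T, if y ∈ V d then f d else 0) - ∑ d ∈ T, if y ∈ V d then h d else 0‖
      ≤ T.card * η := by
    rw [← Finset.sum_sub_distrib, ← nsmul_eq_mul]
    refine (norm_sum_le _ _).trans (Finset.sum_le_card_nsmul _ _ _ fun d _ => ?_)
    split_ifs
    · exact hfh d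
    · simpa using hη0.le
  set Sf := ∑ d ∈ T, if y ∈ V d then f d else 0
  set Sh := ∑ d ∈ T, if y ∈ V d then h d else 0
  calc ‖f y - Sf‖ = ‖(f y - h y) + (h y - Sh) - (Sf - Sh)‖ := by congr 1; ring
    _ ≤ ‖f y - h y‖ + ‖h y - Sh‖ + ‖Sf - Sh‖ :=
      (norm_sub_le _ _).trans (add_le_add_left (norm_add_le _ _) _)
    _ < η + η + T.card * η := by linarith [hfh y]
    _ = ε := by rw [hη]; field_simp; ring

open Classical in
/-- Near a point of a finite saturated set `T`, the locally constant model of `f` vanishes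
wherever `f` does. -/
theorem eventually_sum_eq_zero {T : Finset G} {V : G → Set G}
    (hV : ∀ d ∈ T, D.IsOpenBisection (V d) ∧ d ∈ V d)
    (hs : ∀ g ∈ T, ∀ h ∈ T, D.s g = D.s h)
    (hT : ∀ g ∈ T, ∀ h, ¬ Disjoint (𝓝 h) (𝓝 g) → h ∈ T)
    {f : G → ℂ} (hf : ∀ ε : ℝ, 0 < ε → ∃ h ∈ D.CcSpan, ∀ g : G, ‖f g - h g‖ ≤ ε)
    {g : G} (hg : g ∈ T) :
    ∀ᶠ y in 𝓝 g, f y = 0 → (∑ d ∈ T, if y ∈ V d then f d else 0) = 0 := by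
  set P : Finset ℂ := (T.powerset.image fun S => ∑ d ∈ S, f d).erase 0
  have hP : ((P : Set ℂ)ᶜ) ∈ 𝓝 (0 : ℂ) := P.finite_toSet.isClosed.isOpen_compl.mem_nhds (by simp [P])
  have ht := (tendsto_sub_sum_of_uniform_limit hV hs hT hf hg).neg
  rw [neg_zero] at ht
  filter_upwards [ht hP] with y hy hfy
  by_contra hne
  simp only [mem_preimage, hfy, zero_sub, neg_neg] at hy
  refine hy ?_
  rw [Finset.mem_coe, Finset.mem_erase]
  exact ⟨hne, Finset.mem_image.2 ⟨T.filter fun d => y ∈ V d,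
    Finset.mem_powerset.2 (Finset.filter_subset _ _), Finset.sum_filter _ _⟩⟩

theorem IsOpenBisection.isCompact_inter_preimage_s {V K : Set G} (hV : D.IsOpenBisection V)
    (hK : IsCompact K) (hKV : K ⊆ D.s '' V) : IsCompact (V ∩ D.s ⁻¹' K) := by
  have hemb : IsOpenEmbedding (V.domRestrict D.s) := by
    refine .of_continuous_injective_isOpenMap (D.continuous_s.comp continuous_subtype_val)
      (injOn_iff_injective.1 hV.2.2.1) fun A hA => ?_
    rw [domRestrict_eq, image_comp]
    exact hV.2.2.2.2 _ (Subtype.coe_image_subset _ _) (hV.1.isOpenMap_subtype_val A hA)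
  have hc := hemb.isInducing.isCompact_preimage' hK (by simpa using hKV)
  convert hc.image continuous_subtype_val using 1
  ext y
  simp [and_comm]

theorem exists_bump [LocallyCompactSpace G] [T2Space D.X] (hX : IsOpen D.X) {W : Set G} {y : G}
    (hy : y ∈ D.X) (hW : W ∈ 𝓝 y) :
    ∃ φ : D.X → ℂ, Continuous φ ∧ φ ⟨y, hy⟩ = 1 ∧
      ∃ K : Set G, IsCompact K ∧ K ⊆ W ∧ ∀ x : D.X, φ x ≠ 0 → x.1 ∈ K := by
  have : LocallyCompactSpace D.X := hX.locallyCompactSpace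
  have hW' : Subtype.val ⁻¹' W ∈ 𝓝 (⟨y, hy⟩ : D.X) := continuous_subtype_val.continuousAt hW
  obtain ⟨K, hK, hKW, hKc⟩ := local_compact_nhds hW'
  obtain ⟨φ, hφ1, hφ0, -⟩ := exists_continuous_one_zero_of_isCompact
    (isCompact_singleton (x := (⟨y, hy⟩ : D.X))) isOpen_interior.isClosed_compl
    (disjoint_compl_right_iff_subset.2 (singleton_subset_iff.2 (mem_interior_iff_mem_nhds.2 hK)))
  refine ⟨fun x => φ x, by fun_prop, by simpa using hφ1 rfl, Subtype.val '' K,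
    hKc.image continuous_subtype_val, image_subset_iff.2 hKW, fun x hx => ?_⟩
  refine ⟨x, interior_subset ?_, rfl⟩
  by_contra h
  exact hx (by simpa using hφ0 h)

open Classical in
theorem IsOpenBisection.memCc_ite_mul {V K : Set G} (hV : D.IsOpenBisection V) {φ : D.X → ℂ}
    (hφ : Continuous φ) (hK : IsCompact K) (hKV : K ⊆ D.s '' V)
    (hφK : ∀ x : D.X, φ x ≠ 0 → x.1 ∈ K) :
    MemCc V (fun y => if y ∈ V then φ ⟨D.s y, D.s_mem y⟩ else 0) := by
  refine ⟨?_, fun y hy => if_neg hy, V ∩ D.s ⁻¹' K, hV.isCompact_inter_preimage_s hK hKV,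
    inter_subset_left, fun y hy => ?_⟩
  · have : Continuous fun y => φ ⟨D.s y, D.s_mem y⟩ := hφ.comp (D.continuous_s.subtype_mk _)
    exact this.continuousOn.congr fun y hy => if_pos hy
  · by_cases hyV : y ∈ V
    · exact ⟨hyV, hφK ⟨D.s y, D.s_mem y⟩ (by simpa [hyV] using hy)⟩
    · simp [hyV] at hy

open Classical in
/-- A uniform limit of functions in `𝒞_c(G)` which does not vanish at `g₀` dominates the support
of some function in `𝒞_c(G)` which does not vanish at `g₀`. -/
theorem IsEtale.exists_mem_CcSpan_support_subset [LocallyCompactSpace G] [T2Space D.X]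
    (hD : D.IsEtale) (hX : IsOpen D.X)
    (hfin : ∀ x ∈ D.X, {g : G | g ∈ closure D.X ∧ D.r g = x ∧ D.s g = x}.Finite)
    {f : G → ℂ} (hf : ∀ ε : ℝ, 0 < ε → ∃ h ∈ D.CcSpan, ∀ g : G, ‖f g - h g‖ ≤ ε)
    {g₀ : G} (hg₀ : f g₀ ≠ 0) :
    ∃ k ∈ D.CcSpan, k g₀ ≠ 0 ∧ {g | k g ≠ 0} ⊆ {g | f g ≠ 0} := by
  obtain ⟨T, hgT, hTs, hT⟩ := hD.exists_finite_saturated hfin g₀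
  choose V hVb hVm using hD
  have hV : ∀ d ∈ T, D.IsOpenBisection (V d) ∧ d ∈ V d := fun d _ => ⟨hVb d, hVm d⟩
  have hs : ∀ g ∈ T, ∀ h ∈ T, D.s g = D.s h := fun g hg h hh => (hTs g hg).trans (hTs h hh).symm
  let A : G → Set G := fun d => {y | f y = 0 → (∑ e ∈ T, if y ∈ V e then f e else 0) = 0} ∩ V d
  have hA : ∀ d ∈ T, A d ∈ 𝓝 d := fun d hd =>
    inter_mem (eventually_sum_eq_zero hV hs hT hf hd) ((hVb d).1.mem_nhds (hVm d))
  have hW : (⋂ d ∈ T, D.s '' A d) ∈ 𝓝 (D.s g₀) := by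
    refine (Filter.biInter_finset_mem T).2 fun d hd => ?_
    rw [← hTs d hd]
    exact IsEtale.image_s_mem_nhds (fun g => ⟨V g, hVb g, hVm g⟩) (hA d hd)
  obtain ⟨φ, hφ, hφ1, K, hK, hKW, hφK⟩ := exists_bump hX (D.s_mem g₀) hW
  have hKA : ∀ d ∈ T, K ⊆ D.s '' A d := fun d hd => hKW.trans (biInter_subset_of_mem hd)
  let k : G → ℂ := ∑ d ∈ T, f d • fun y => if y ∈ V d then φ ⟨D.s y, D.s_mem y⟩ else 0
  have hk : ∀ y, k y = φ ⟨D.s y, D.s_mem y⟩ * ∑ d ∈ T, if y ∈ V d then f d else 0 := by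
    intro y
    simp only [k, Finset.sum_apply, Pi.smul_apply, smul_eq_mul, Finset.mul_sum]
    exact Finset.sum_congr rfl fun d _ => by split_ifs <;> ring
  refine ⟨k, ?_, ?_, ?_⟩
  · refine Submodule.sum_mem _ fun d hd => Submodule.smul_mem _ _ (Submodule.subset_span ?_)
    exact ⟨V d, hVb d, (hVb d).memCc_ite_mul hφ hK
      ((hKA d hd).trans (image_mono inter_subset_right)) hφK⟩
  · rw [hk, hφ1, one_mul, Finset.sum_eq_single_of_mem g₀ hgT, if_pos (hVm g₀)]
    · exact hg₀
    · intro d hd hne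
      exact if_neg fun h => hne ((hVb d).2.2.1 (hVm d) h (hTs d hd))
  · intro y hy hfy
    rw [mem_ofPred_eq, hk, mul_ne_zero_iff] at hy
    obtain ⟨d, hd, hyd⟩ := Finset.exists_ne_zero_of_sum_ne_zero hy.2
    have hyV : y ∈ V d := by
      by_contra h
      exact hyd (if_neg h)
    obtain ⟨a, ha, hay⟩ := hKA d hd (hφK _ hy.1)
    obtain rfl : a = y := (hVb d).2.2.1 ha.2 hyV hay
    exact hy.2 (ha.1 hfy)

end GroupoidData

end

/-- Let `G` be a non-Hausdorff étale groupoid such that for every unit `x`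
the set `X̄(x) = X̄ ∩ G_x^x` is finite, where `X̄` is the closure of the unit space `X` in `G`.
If `J ∩ 𝒞_c(G) = {0}`, then the singular ideal `J` of `C*_r(G)` is zero.

As in Statement 8, elements of `C*_r(G)` are represented faithfully as functions `G → ℂ`
which are uniform limits of elements of `𝒞_c(G)` (the reduced norm dominates the sup norm),
and `f ∈ J` means that `s(supp°(f))` has empty interior. -/
theorem stmt16 [LocallyCompactSpace G] (D : GroupoidData G) [T2Space ↥D.X]
    (hXopen : IsOpen D.X) (hetale : D.IsEtale) (hnH : ¬ T2Space G)
    (hfin : ∀ x ∈ D.X, {g : G | g ∈ closure D.X ∧ D.r g = x ∧ D.s g = x}.Finite)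
    (hJCc : ∀ f : G → ℂ, f ∈ D.CcSpan →
      interior (D.s '' {g : G | f g ≠ 0}) = ∅ → f = 0)
    (f : G → ℂ)
    (hf : ∀ ε : ℝ, 0 < ε → ∃ h ∈ D.CcSpan, ∀ g : G, ‖f g - h g‖ ≤ ε)
    (hsing : interior (D.s '' {g : G | f g ≠ 0}) = ∅) :
    f = 0 := by
  by_contra hne
  obtain ⟨g₀, hg₀⟩ := Function.ne_iff.1 hne
  obtain ⟨k, hk, hk₀, hsub⟩ := hetale.exists_mem_CcSpan_support_subset hXopen hfin hf hg₀
  have hint : interior (D.s '' {g : G | k g ≠ 0}) = ∅ :=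
    Set.subset_eq_empty (interior_mono (Set.image_mono hsub)) hsing
  exact hk₀ (congrFun (hJCc k hk hint) g₀)
end
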